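/- Let λ ≥ 1 be an integer, let G be a λ-connected finite simple graph with n vertices and minimum degree δ, and let C be a longest cycle in G. If δ ≥ (n+2)/(λ+1) + λ − 2, then c̄ ≤ min{λ − 1, δ − λ}, where c̄ is the length of a longest cycle in the subgraph of G induced by the vertices not on C. -/

import Mathlib

open SimpleGraph

/-- A cycle `C` is a longest cycle in `G` if no cycle of `G` has greater length. -/
def IsLongestCycle {V : Type*} (G : SimpleGraph V) {v : V} (C : G.Walk v v) : Prop :=
  C.IsCycle ∧ ∀ (u : V) (D : G.Walk u u), D.IsCycle → D.length ≤ C.length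

open scoped Classical in
/-- The length of a longest path in `H`, with the convention that it is `-1`
when `H` has no vertices. -/
noncomputable def pbar {W : Type*} (H : SimpleGraph W) : ℤ :=
  if Nonempty W then
    ((sSup {n : ℕ | ∃ (u v : W) (p : H.Walk u v), p.IsPath ∧ p.length = n} : ℕ) : ℤ)
  else -1

/-- The length of a longest cycle in `H`, where a single vertex counts as a cycle of
length 1 and a single edge as a cycle of length 2, with the convention that it is `0`
when `H` has no vertices. -/
noncomputable def cbar {W : Type*} (H : SimpleGraph W) : ℕ :=
  sSup {n : ℕ | (n = 1 ∧ Nonempty W) ∨ (n = 2 ∧ ∃ u v : W, H.Adj u v) ∨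
    ∃ (v : W) (c : H.Walk v v), c.IsCycle ∧ c.length = n}

/-- `G` is `k`-connected: it has at least `k+1` vertices and remains connected
after the deletion of any set of fewer than `k` vertices. -/
def IsKConnected {V : Type*} [Fintype V] (G : SimpleGraph V) (k : ℕ) : Prop :=
  k + 1 ≤ Fintype.card V ∧
    ∀ S : Finset V, S.card < k → (G.induce ((↑S : Set V)ᶜ)).Connected

section

variable {V : Type*}

/-- There is a path of length `n` from `u` to `v` in `G` all of whose vertices lie in `S`. -/
def PathOn (G : SimpleGraph V) (S : Set V) (u v : V) (n : ℕ) : Prop :=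
  ∃ p : G.Walk u v, p.IsPath ∧ p.length = n ∧ ∀ x ∈ p.support, x ∈ S

namespace PathOn

variable {G : SimpleGraph V} {S T : Set V} {u v w x : V} {m n : ℕ}

theorem mono (h : PathOn G S u v n) (hST : S ⊆ T) : PathOn G T u v n := by
  obtain ⟨p, hp, hn, hs⟩ := h
  exact ⟨p, hp, hn, fun x hx => hST (hs x hx)⟩

theorem symm (h : PathOn G S u v n) : PathOn G S v u n := by
  obtain ⟨p, hp, hn, hs⟩ := h
  exact ⟨p.reverse, hp.reverse, by simpa using hn, fun x hx => hs x (by simpa using hx)⟩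

theorem refl (hu : u ∈ S) : PathOn G S u u 0 :=
  ⟨.nil, .nil, rfl, by simpa using hu⟩

theorem singleton : PathOn G {u} u u 0 := refl rfl

theorem left_mem (h : PathOn G S u v n) : u ∈ S := by
  obtain ⟨p, -, -, hs⟩ := h
  exact hs u p.start_mem_support

theorem right_mem (h : PathOn G S u v n) : v ∈ S := h.symm.left_mem

theorem append (h₁ : PathOn G S u v m) (h₂ : PathOn G T w x n) (hST : Disjoint S T)
    (hvw : G.Adj v w) : PathOn G (S ∪ T) u x (m + n + 1) := by
  obtain ⟨p, hp, hm, hps⟩ := h₁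
  obtain ⟨q, hq, hn, hqs⟩ := h₂
  refine ⟨p.append (.cons hvw q), ?_, by simp [hm, hn]; omega, ?_⟩
  · rw [Walk.isPath_def, Walk.support_append, Walk.support_cons, List.tail_cons,
      List.nodup_append]
    refine ⟨hp.support_nodup, hq.support_nodup, ?_⟩
    rintro a ha b hb rfl
    exact Set.disjoint_left.1 hST (hps a ha) (hqs a hb)
  · intro y hy
    rw [Walk.support_append, Walk.support_cons, List.tail_cons, List.mem_append] at hy
    exact hy.imp (hps y) (hqs y)

theorem isCycle (h₁ : PathOn G S u v m) (h₂ : PathOn G T w x n) (hST : Disjoint S T)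
    (hvw : G.Adj v w) (hxu : G.Adj x u) (hmn : 1 ≤ m + n) :
    ∃ (y : V) (c : G.Walk y y), c.IsCycle ∧ c.length = m + n + 2 ∧
      ∀ z ∈ c.support, z ∈ S ∪ T := by
  obtain ⟨p, hp, hl, hs⟩ := h₁.append h₂ hST hvw
  refine ⟨x, .cons hxu p, ?_, by simp [hl], ?_⟩
  · rw [Walk.cons_isCycle_iff]
    refine ⟨hp, fun he => ?_⟩
    have h1 := hp.length_eq_one_of_mem_edges (by rwa [Sym2.eq_swap] at he)
    omega
  · intro z hz
    rw [Walk.support_cons, List.mem_cons] at hz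
    rcases hz with rfl | hz
    · exact Or.inr h₂.right_mem
    · exact hs z hz

theorem of_seq (f : ℕ → V) (a d : ℕ) (hadj : ∀ x, a ≤ x → x < a + d → G.Adj (f x) (f (x + 1)))
    (hinj : Set.InjOn f (Set.Icc a (a + d))) :
    PathOn G (f '' Set.Icc a (a + d)) (f a) (f (a + d)) d := by
  induction d with
  | zero => exact refl ⟨a, by simp, rfl⟩
  | succ d ih =>
    have h := (ih (fun x h1 h2 => hadj x h1 (by omega))
      (hinj.mono (Set.Icc_subset_Icc_right (by omega)))).append
      (singleton (G := G) (u := f (a + (d + 1)))) ?_ (hadj (a + d) (by omega) (by omega))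
    · refine h.mono ?_
      rintro _ (⟨y, hy, rfl⟩ | rfl)
      · exact ⟨y, ⟨hy.1, hy.2.trans (by omega)⟩, rfl⟩
      · exact ⟨_, ⟨by omega, le_rfl⟩, rfl⟩
    · rw [Set.disjoint_singleton_right]
      rintro ⟨y, hy, he⟩
      have := hinj ⟨hy.1, hy.2.trans (by omega)⟩ ⟨by omega, le_rfl⟩ he
      have := hy.2
      omega

end PathOn

/-- The sequence `f` runs periodically around a cycle of length `c` which is longest among the
cycles with all vertices in `A`; single vertices and edges count as cycles of length `1`
and `2`. -/
structure CycSeq (G : SimpleGraph V) (A : Set V) (f : ℕ → V) (c : ℕ) : Prop where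
  pos : 0 < c
  per : ∀ x, f (x + c) = f x
  inj : ∀ x y, f x = f y → x ≡ y [MOD c]
  mem : ∀ x, f x ∈ A
  adj : 2 ≤ c → ∀ x, G.Adj (f x) (f (x + 1))
  max : ∀ (y : V) (w : G.Walk y y), w.IsCycle → (∀ z ∈ w.support, z ∈ A) → w.length ≤ c
  edge : c = 1 → ∀ x ∈ A, ∀ y ∈ A, ¬ G.Adj x y

theorem Nat.ModEq.eq_of_lt_add {c x y : ℕ} (h : x ≡ y [MOD c]) (h1 : x ≤ y) (h2 : y < x + c) :
    x = y := by
  have := (Nat.modEq_iff_dvd' h1).1 h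
  have := Nat.eq_zero_of_dvd_of_lt this (by omega)
  omega

theorem Nat.exists_add_modEq {c : ℕ} (hc : 0 < c) (a b : ℕ) : ∃ d < c, a + d ≡ b [MOD c] := by
  refine ⟨(b + a * (c - 1)) % c, Nat.mod_lt _ hc, ?_⟩
  have h : a + (b + a * (c - 1)) = b + a * c := by
    obtain ⟨e, rfl⟩ : ∃ e, c = e + 1 := ⟨c - 1, by omega⟩
    rw [Nat.add_sub_cancel]
    ring
  rw [Nat.ModEq, Nat.add_mod_mod, h, Nat.add_mul_mod_self_right]

namespace CycSeq

variable {G : SimpleGraph V} {A S : Set V} {f : ℕ → V} {c : ℕ}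

theorem eq_of_modEq (hf : CycSeq G A f c) {x y : ℕ} (h : x ≡ y [MOD c]) : f x = f y := by
  have hp : Function.Periodic f c := hf.per
  rw [← hp.map_mod_nat x, ← hp.map_mod_nat y, h]

theorem arc (hf : CycSeq G A f c) {x y : ℕ} (hxy : x ≤ y) (hy : y < x + c) :
    PathOn G (f '' Set.Icc x y) (f x) (f y) (y - x) := by
  have h := PathOn.of_seq (G := G) f x (y - x)
    (fun z h1 h2 => hf.adj (by omega) z) ?_
  · rwa [Nat.add_sub_cancel' hxy] at h
  · rw [Nat.add_sub_cancel' hxy]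
    rintro a ⟨ha, ha'⟩ b ⟨hb, hb'⟩ hab
    have h := hf.inj _ _ hab
    rcases le_total a b with h1 | h1
    · exact h.eq_of_lt_add h1 (by omega)
    · exact (h.symm.eq_of_lt_add h1 (by omega)).symm

theorem gap (hf : CycSeq G A f c) {x y m : ℕ} {p q : V} (hxy : x < y) (hy : y < x + c)
    (hS : PathOn G S p q m) (hSA : S ⊆ A) (hSf : Disjoint S (Set.range f))
    (hp : G.Adj (f x) p) (hq : G.Adj (f y) q) : m + 2 ≤ y - x := by
  have h := hf.arc (x := y) (y := x + c) (by omega) (by omega)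
  rw [hf.per] at h
  obtain ⟨z, w, hw, hl, hs⟩ := hS.isCycle h
    (hSf.mono_right (Set.image_subset_range _ _)) hq.symm hp (by omega)
  have := hf.max z w hw fun t ht => (hs t ht).elim (fun h => hSA h) (by
    rintro ⟨u, -, rfl⟩; exact hf.mem u)
  omega

theorem exists_of_isCycle {v : V} {w : G.Walk v v} (hw : w.IsCycle) (hA : ∀ z ∈ w.support, z ∈ A)
    (hmax : ∀ (y : V) (w' : G.Walk y y), w'.IsCycle → (∀ z ∈ w'.support, z ∈ A) →
      w'.length ≤ w.length) :
    ∃ f, CycSeq G A f w.length ∧ Set.range f = {x | x ∈ w.support} := by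
  have h3 := hw.three_le_length
  have hpos : 0 < w.length := by omega
  refine ⟨fun x => w.getVert (x % w.length), ⟨hpos, by simp, ?_, ?_, ?_, hmax, by omega⟩, ?_⟩
  · intro x y hxy
    have := hw.getVert_injOn' (by have := Nat.mod_lt x hpos; simp; omega)
      (by have := Nat.mod_lt y hpos; simp; omega) hxy
    exact this
  · intro x
    exact hA _ (w.getVert_mem_support _)
  · intro _ x
    have hlt := Nat.mod_lt x hpos
    have h := w.adj_getVert_succ hlt
    show G.Adj (w.getVert (x % w.length)) (w.getVert ((x + 1) % w.length))
    rw [Nat.add_mod_eq_ite]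
    rw [Nat.mod_eq_of_lt (a := 1) (by omega)]
    split_ifs with h'
    · have : x % w.length + 1 = w.length := by omega
      rw [this] at h ⊢
      simpa using h
    · exact h
  · ext x
    constructor
    · rintro ⟨y, rfl⟩
      exact w.getVert_mem_support _
    · intro hx
      obtain ⟨n, hn, hnl⟩ := (Walk.mem_support_iff_exists_getVert).1 hx
      rcases hnl.lt_or_eq with h | h
      · exact ⟨n, by simpa [Nat.mod_eq_of_lt h] using hn⟩
      · refine ⟨0, ?_⟩
        subst h
        simpa using hn

end CycSeq

theorem CycSeq.exists_cbar [Finite V] (G : SimpleGraph V) {A : Set V} (hA : A.Nonempty) :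
    ∃ f, CycSeq G A f (cbar (G.induce A)) := by
  cases nonempty_fintype V
  set s : Set ℕ := {n : ℕ | (n = 1 ∧ Nonempty A) ∨ (n = 2 ∧ ∃ u v : A, (G.induce A).Adj u v) ∨
    ∃ (v : A) (c : (G.induce A).Walk v v), c.IsCycle ∧ c.length = n} with hs
  have hne : s.Nonempty := ⟨1, Or.inl ⟨rfl, hA.to_subtype⟩⟩
  have hbdd : BddAbove s := by
    classical
    refine ⟨Fintype.card A + 2, ?_⟩
    rintro n (⟨rfl, -⟩ | ⟨rfl, -⟩ | ⟨v, c, hc, rfl⟩)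
    · omega
    · omega
    · have := hc.isPath_tail.length_lt
      have := c.length_tail_add_one hc.not_nil
      omega
  have hmem : cbar (G.induce A) ∈ s := Nat.sSup_mem hne hbdd
  have hle : ∀ n ∈ s, n ≤ cbar (G.induce A) := fun n hn => le_csSup hbdd hn
  generalize cbar (G.induce A) = c at hmem hle
  have hmax : ∀ (y : V) (w : G.Walk y y), w.IsCycle → (∀ z ∈ w.support, z ∈ A) →
      w.length ≤ c := by
    intro y w hw hwA
    refine hle _ (Or.inr (Or.inr ⟨⟨y, hwA y w.start_mem_support⟩, w.induce A hwA, ?_, ?_⟩))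
    · refine (Walk.isCycle_map_iff_of_injective (f := (Embedding.induce (G := G) A).toHom)
        (Embedding.induce (G := G) A).injective).1 ?_
      rw [Walk.map_induce]
      exact hw
    · have h := congrArg Walk.length (Walk.map_induce w hwA)
      exact ((w.induce A hwA).length_map (Embedding.induce (G := G) A).toHom).symm.trans h
  have hedge : c = 1 → ∀ x ∈ A, ∀ y ∈ A, ¬ G.Adj x y := by
    rintro rfl x hx y hy hxy
    have := hle 2 (Or.inr (Or.inl ⟨rfl, ⟨x, hx⟩, ⟨y, hy⟩, hxy⟩))
    omega
  rcases hmem with ⟨rfl, ⟨x, hx⟩⟩ | ⟨rfl, u, v, huv⟩ | ⟨v, w, hw, rfl⟩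
  · exact ⟨fun _ => x, one_pos, fun _ => rfl, fun _ _ _ => Nat.modEq_one, fun _ => hx,
      by omega, hmax, hedge⟩
  · have huv' : G.Adj u v := huv
    refine ⟨fun n => if n % 2 = 0 then u else v, two_pos, ?_, ?_, ?_, ?_, hmax, hedge⟩
    · simp
    · intro x y h
      have := huv'.ne
      have hx := Nat.mod_two_eq_zero_or_one x
      have hy := Nat.mod_two_eq_zero_or_one y
      unfold Nat.ModEq
      rcases hx with hx | hx <;> rcases hy with hy | hy <;> simp_all
    · intro x
      split_ifs
      exacts [u.2, v.2]
    · intro _ x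
      have := huv'.symm
      rcases Nat.mod_two_eq_zero_or_one x with hx | hx <;> simp [hx, Nat.add_mod, huv', this]
  · have hl : (w.map (Embedding.induce A).toHom).length = w.length := w.length_map _
    have hA' : ∀ z ∈ (w.map (Embedding.induce A).toHom).support, z ∈ A := by
      intro z hz
      rw [Walk.support_map, List.mem_map] at hz
      obtain ⟨y, -, rfl⟩ := hz
      exact y.2
    obtain ⟨f, hf, -⟩ := CycSeq.exists_of_isCycle
      (hw.map (f := (Embedding.induce (G := G) A).toHom) (Embedding.induce (G := G) A).injective)
      hA' (by rw [hl]; exact hmax)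
    exact ⟨f, by rwa [hl] at hf⟩

/-- A system of disjoint paths `z i 0, …, z i (ℓ i)` in `A`, one starting at each vertex `f i` of
the cycle of length `c` described by `f`. -/
structure Legs (G : SimpleGraph V) (A : Set V) (f : ℕ → V) (c : ℕ) (ℓ : ℕ → ℕ)
    (z : ℕ → ℕ → V) : Prop where
  per_len : ∀ i, ℓ (i + c) = ℓ i
  per : ∀ i t, z (i + c) t = z i t
  zero : ∀ i, z i 0 = f i
  mem : ∀ i t, t ≤ ℓ i → z i t ∈ A
  adj : ∀ i t, t < ℓ i → G.Adj (z i t) (z i (t + 1))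
  inj : ∀ i t j s, t ≤ ℓ i → s ≤ ℓ j → z i t = z j s → i ≡ j [MOD c] ∧ t = s

/-- All neighbours in `A` of the ends of the legs lie on legs. -/
def Legs.Saturated (G : SimpleGraph V) (A : Set V) (ℓ : ℕ → ℕ) (z : ℕ → ℕ → V) : Prop :=
  ∀ i, ∀ x ∈ A, G.Adj (z i (ℓ i)) x → ∃ j t, t ≤ ℓ j ∧ z j t = x

namespace CycSeq

variable {G : SimpleGraph V} {A : Set V} {f : ℕ → V} {c : ℕ}

theorem legs (hf : CycSeq G A f c) : Legs G A f c (fun _ => 0) (fun i _ => f i) where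
  per_len _ := rfl
  per i _ := hf.per i
  zero _ := rfl
  mem i _ _ := hf.mem i
  adj _ _ h := by simp at h
  inj i t j s ht hs h := ⟨hf.inj _ _ h, by simp at ht hs; omega⟩

end CycSeq

theorem Function.Periodic.eq_of_modEq {α : Type*} {g : ℕ → α} {c : ℕ} (hg : Function.Periodic g c)
    {i j : ℕ} (h : i ≡ j [MOD c]) : g i = g j := by
  rw [← hg.map_mod_nat i, ← hg.map_mod_nat j, h]

namespace Legs

variable {G : SimpleGraph V} {A : Set V} {f : ℕ → V} {c : ℕ} {ℓ : ℕ → ℕ} {z : ℕ → ℕ → V}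

theorem len_eq (h : Legs G A f c ℓ z) {i j : ℕ} (hij : i ≡ j [MOD c]) : ℓ i = ℓ j :=
  Function.Periodic.eq_of_modEq h.per_len hij

theorem eq (h : Legs G A f c ℓ z) {i j : ℕ} (hij : i ≡ j [MOD c]) : z i = z j :=
  Function.Periodic.eq_of_modEq (fun i => funext (h.per i)) hij

theorem add_sum_le_ncard [Finite V] (h : Legs G A f c ℓ z) :
    c + ∑ i ∈ Finset.range c, ℓ i ≤ A.ncard := by
  classical
  have h1 : ((Finset.range c).sigma fun i => Finset.range (ℓ i + 1)).card =
      c + ∑ i ∈ Finset.range c, ℓ i := by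
    simp [Finset.card_sigma, Finset.sum_add_distrib, add_comm]
  rw [← h1, Set.ncard_eq_toFinset_card A]
  refine Finset.card_le_card_of_injOn (fun p => z p.1 p.2) ?_ ?_
  · rintro ⟨i, t⟩ hp
    simp only [Finset.coe_sigma, Set.mem_sigma_iff, Finset.mem_coe, Finset.mem_range] at hp
    simpa using h.mem i t (by omega)
  · rintro ⟨i, t⟩ hp ⟨j, s⟩ hq hpq
    simp only [Finset.coe_sigma, Set.mem_sigma_iff, Finset.mem_coe, Finset.mem_range] at hp hq
    obtain ⟨h1, rfl⟩ := h.inj i t j s (by omega) (by omega) hpq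
    have : i = j := by
      have := h1
      rwa [Nat.ModEq, Nat.mod_eq_of_lt hp.1, Nat.mod_eq_of_lt hq.1] at this
    rw [this]

theorem extend (h : Legs G A f c ℓ z) (i : ℕ) {x : V} (hx : x ∈ A) (hadj : G.Adj (z i (ℓ i)) x)
    (hnew : ∀ j t, t ≤ ℓ j → z j t ≠ x) :
    Legs G A f c (fun j => if j ≡ i [MOD c] then ℓ j + 1 else ℓ j)
      (fun j t => if j ≡ i [MOD c] ∧ t = ℓ i + 1 then x else z j t) := by
  have hmod : ∀ j, j + c ≡ i [MOD c] ↔ j ≡ i [MOD c] := fun j => by simp [Nat.ModEq]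
  have hlen : ∀ j, j ≡ i [MOD c] → ℓ j = ℓ i := fun j hj => h.len_eq hj
  have hz : ∀ j, j ≡ i [MOD c] → z j = z i := fun j hj => h.eq hj
  refine ⟨?_, ?_, ?_, ?_, ?_, ?_⟩
  · intro j
    simp only [hmod, h.per_len]
  · intro j t
    simp only [hmod, h.per]
  · intro j
    simp [h.zero]
  · intro j t ht
    by_cases h2 : j ≡ i [MOD c] ∧ t = ℓ i + 1
    · rwa [if_pos h2]
    · rw [if_neg h2]
      refine h.mem j t ?_
      split_ifs at ht with h1
      · have := hlen j h1
        have : t ≠ ℓ i + 1 := fun h => h2 ⟨h1, h⟩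
        omega
      · exact ht
  · intro j t ht
    by_cases h1 : j ≡ i [MOD c]
    · have hl := hlen j h1
      simp only [h1, if_true, true_and] at ht ⊢
      rw [if_neg (by omega)]
      split_ifs with h2
      · rw [hz j h1]
        have : t = ℓ i := by omega
        rwa [this]
      · exact h.adj j t (by omega)
    · simp only [h1, if_false, false_and] at ht ⊢
      exact h.adj j t ht
  · intro j t k s ht hs heq
    split_ifs at heq with h1 h2 h2
    · exact ⟨h1.1.trans h2.1.symm, h1.2.trans h2.2.symm⟩
    · refine absurd heq.symm (hnew k s ?_)
      split_ifs at hs with h3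
      · have := hlen k h3
        have : s ≠ ℓ i + 1 := fun h => h2 ⟨h3, h⟩
        omega
      · exact hs
    · refine absurd heq (hnew j t ?_)
      split_ifs at ht with h3
      · have := hlen j h3
        have : t ≠ ℓ i + 1 := fun h => h1 ⟨h3, h⟩
        omega
      · exact ht
    · refine h.inj j t k s ?_ ?_ heq
      · split_ifs at ht with h3
        · have := hlen j h3
          have : t ≠ ℓ i + 1 := fun h => h1 ⟨h3, h⟩
          omega
        · exact ht
      · split_ifs at hs with h3
        · have := hlen k h3
          have : s ≠ ℓ i + 1 := fun h => h2 ⟨h3, h⟩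
          omega
        · exact hs

theorem exists_saturated [Finite V] (hc : 0 < c) (h : Legs G A f c ℓ z) :
    ∃ ℓ' z', Legs G A f c ℓ' z' ∧ Saturated G A ℓ' z' ∧ (∀ i, ℓ i ≤ ℓ' i) ∧
      ∀ i t, t ≤ ℓ i → z' i t = z i t := by
  induction hn : A.ncard - ∑ i ∈ Finset.range c, ℓ i using Nat.strong_induction_on
    generalizing ℓ z with
  | _ n ih =>
  by_cases hs : Saturated G A ℓ z
  · exact ⟨ℓ, z, h, hs, fun _ => le_rfl, fun _ _ _ => rfl⟩
  · unfold Saturated at hs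
    push Not at hs
    obtain ⟨i, x, hx, hadj, hnew⟩ := hs
    have h' := h.extend i hx hadj hnew
    have hlt : ∑ j ∈ Finset.range c, ℓ j <
        ∑ j ∈ Finset.range c, (if j ≡ i [MOD c] then ℓ j + 1 else ℓ j) := by
      refine Finset.sum_lt_sum (fun j _ => by split_ifs <;> omega)
        ⟨i % c, Finset.mem_range.2 (Nat.mod_lt _ hc), ?_⟩
      rw [if_pos (Nat.mod_modEq i c)]
      omega
    have := h'.add_sum_le_ncard
    obtain ⟨ℓ', z', h1, h2, h3, h4⟩ := ih _ (by omega) h' rfl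
    refine ⟨ℓ', z', h1, h2, fun j => le_trans ?_ (h3 j), fun j t ht => ?_⟩
    · split_ifs <;> omega
    · rw [h4 j t (by split_ifs <;> omega), if_neg]
      rintro ⟨h5, rfl⟩
      have := h.len_eq h5
      omega

/-- The vertex set of the `i`-th leg. -/
def leg (ℓ : ℕ → ℕ) (z : ℕ → ℕ → V) (i : ℕ) : Set V := z i '' Set.Icc 0 (ℓ i)

/-- The vertex set of the `i`-th leg without its first vertex. -/
def leg' (ℓ : ℕ → ℕ) (z : ℕ → ℕ → V) (i : ℕ) : Set V := z i '' Set.Icc 1 (ℓ i)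

theorem leg'_subset_leg (i : ℕ) : leg' ℓ z i ⊆ leg ℓ z i :=
  Set.image_mono (Set.Icc_subset_Icc_left (by omega))

theorem leg_subset (h : Legs G A f c ℓ z) (i : ℕ) : leg ℓ z i ⊆ A := by
  rintro _ ⟨t, ht, rfl⟩
  exact h.mem i t ht.2

theorem leg'_subset (h : Legs G A f c ℓ z) (i : ℕ) : leg' ℓ z i ⊆ A :=
  (leg'_subset_leg i).trans (h.leg_subset i)

theorem disjoint_leg (h : Legs G A f c ℓ z) {i j : ℕ} (hij : ¬ i ≡ j [MOD c]) :
    Disjoint (leg ℓ z i) (leg ℓ z j) := by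
  rw [Set.disjoint_left]
  rintro _ ⟨t, ht, rfl⟩ ⟨s, hs, h'⟩
  exact hij (h.inj j s i t hs.2 ht.2 h').1.symm

theorem disjoint_leg' (h : Legs G A f c ℓ z) (i : ℕ) :
    Disjoint (leg' ℓ z i) (Set.range f) := by
  rw [Set.disjoint_left]
  rintro _ ⟨t, ht, rfl⟩ ⟨j, hj⟩
  rw [← h.zero] at hj
  have := (h.inj j 0 i t (by omega) ht.2 hj).2
  have := ht.1
  omega

theorem seg (h : Legs G A f c ℓ z) (i : ℕ) {s t : ℕ} (hst : s ≤ t) (ht : t ≤ ℓ i) :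
    PathOn G (z i '' Set.Icc s t) (z i s) (z i t) (t - s) := by
  have := PathOn.of_seq (G := G) (z i) s (t - s) (fun x h1 h2 => h.adj i x (by omega)) ?_
  · rwa [Nat.add_sub_cancel' hst] at this
  · rw [Nat.add_sub_cancel' hst]
    rintro a ⟨_, ha⟩ b ⟨_, hb⟩ hab
    exact (h.inj i a i b (by omega) (by omega) hab).2

/-- A path along leg `i` between any two of its vertices. -/
theorem seg' (h : Legs G A f c ℓ z) (i : ℕ) {s t : ℕ} (hs : 1 ≤ s) (hs' : s ≤ ℓ i) (ht : 1 ≤ t)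
    (ht' : t ≤ ℓ i) : ∃ m, s ≤ m + t ∧ t ≤ m + s ∧ PathOn G (leg' ℓ z i) (z i s) (z i t) m := by
  rcases le_total s t with h1 | h1
  · exact ⟨t - s, by omega, by omega, (h.seg i h1 ht').mono
      (Set.image_mono (Set.Icc_subset_Icc hs ht'))⟩
  · exact ⟨s - t, by omega, by omega, (h.seg i h1 hs').symm.mono
      (Set.image_mono (Set.Icc_subset_Icc ht hs'))⟩

theorem down (h : Legs G A f c ℓ z) {i : ℕ} {p : V} (hp : p ∈ leg ℓ z i) :
    ∃ m, PathOn G (leg ℓ z i) p (f i) m := by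
  obtain ⟨t, ht, rfl⟩ := hp
  refine ⟨t - 0, ?_⟩
  rw [← h.zero]
  exact (h.seg i (Nat.zero_le t) ht.2).symm.mono (Set.image_mono (Set.Icc_subset_Icc_right ht.2))

end Legs

theorem PathOn.trans {G : SimpleGraph V} {S T : Set V} {u v w : V} {m n : ℕ}
    (h₁ : PathOn G S u v m) (h₂ : PathOn G T v w n) (hST : ∀ x ∈ S, x ∈ T → x = v) :
    PathOn G (S ∪ T) u w (m + n) := by
  obtain ⟨p, hp, hm, hps⟩ := h₁
  obtain ⟨q, hq, hn, hqs⟩ := h₂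
  refine ⟨p.append q, ?_, by simp [hm, hn], ?_⟩
  · rw [Walk.isPath_def, Walk.support_append, List.nodup_append]
    refine ⟨hp.support_nodup, hq.support_nodup.sublist (List.tail_sublist _), ?_⟩
    rintro a ha b hb rfl
    have := hST a (hps a ha) (hqs a (List.mem_of_mem_tail hb))
    subst this
    have h := hq.support_nodup
    rw [← Walk.cons_tail_support] at h
    exact (List.nodup_cons.1 h).1 hb
  · intro y hy
    rw [Walk.mem_support_append_iff] at hy
    exact hy.imp (hps y) (hqs y)

namespace Legs

variable {G : SimpleGraph V} {A : Set V} {f : ℕ → V} {c : ℕ} {ℓ : ℕ → ℕ} {z : ℕ → ℕ → V}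

/-- There is an edge from `f e` to the first of `t` vertices of a path which ends in `z i g`
and otherwise follows leg `e`. -/
def Att (G : SimpleGraph V) (f : ℕ → V) (ℓ : ℕ → ℕ) (z : ℕ → ℕ → V) (i e g t : ℕ) : Prop :=
  ∃ p m, t = m + 1 ∧ G.Adj (f e) p ∧ PathOn G (insert (z i g) (leg' ℓ z e)) p (z i g) m

/-- There is a path with `m` edges from a neighbour of `f e` to a neighbour of `f e'` which uses
only the legs `e`, `i`, `e'`. -/
def Link (G : SimpleGraph V) (f : ℕ → V) (ℓ : ℕ → ℕ) (z : ℕ → ℕ → V) (i e e' m : ℕ) : Prop :=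
  ∃ p q, G.Adj (f e) p ∧ G.Adj (f e') q ∧
    PathOn G (leg' ℓ z e ∪ leg' ℓ z i ∪ leg' ℓ z e') p q m

theorem Link.symm {i e e' m : ℕ} (h : Link G f ℓ z i e e' m) : Link G f ℓ z i e' e m := by
  obtain ⟨p, q, hp, hq, h⟩ := h
  exact ⟨q, p, hq, hp, h.symm.mono (by intro x; simp only [Set.mem_union]; tauto)⟩

theorem Link.gap (hf : CycSeq G A f c) (hL : Legs G A f c ℓ z) {i e e' m x y : ℕ}
    (h : Link G f ℓ z i e e' m)
    (hx : x ≡ e [MOD c]) (hy : y ≡ e' [MOD c]) (hxy : x < y) (hyx : y < x + c) :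
    m + 2 ≤ y - x := by
  obtain ⟨p, q, hp, hq, h⟩ := h
  rw [← hf.eq_of_modEq hx] at hp
  rw [← hf.eq_of_modEq hy] at hq
  refine hf.gap hxy hyx h ?_ ?_ hp hq
  · simp only [Set.union_subset_iff]
    exact ⟨⟨hL.leg'_subset _, hL.leg'_subset _⟩, hL.leg'_subset _⟩
  · simp only [Set.disjoint_union_left]
    exact ⟨⟨hL.disjoint_leg' _, hL.disjoint_leg' _⟩, hL.disjoint_leg' _⟩

/-- From `f e` one can reach any vertex of leg `i` outside the cycle. -/
theorem Att.to_leg (hL : Legs G A f c ℓ z) {i e g t : ℕ} (hei : ¬ e ≡ i [MOD c])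
    (h : Att G f ℓ z i e g t) (hg : 1 ≤ g) (hg' : g ≤ ℓ i) {s : ℕ} (hs : 1 ≤ s) (hs' : s ≤ ℓ i) :
    ∃ p m, G.Adj (f e) p ∧ t + g ≤ m + 1 + s ∧ t + s ≤ m + 1 + g ∧
      PathOn G (leg' ℓ z e ∪ leg' ℓ z i) p (z i s) m := by
  obtain ⟨p, m, rfl, hp, h⟩ := h
  obtain ⟨n, hn1, hn2, hn⟩ := hL.seg' i hg hg' hs hs'
  refine ⟨p, m + n, hp, by omega, by omega, (h.trans hn ?_).mono ?_⟩
  · rintro x (rfl | hx) hx'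
    · rfl
    · exact absurd (leg'_subset_leg i hx')
        (Set.disjoint_left.1 (hL.disjoint_leg hei) (leg'_subset_leg e hx))
  · rintro x ((rfl | hx) | hx)
    · exact Or.inr ⟨g, ⟨hg, hg'⟩, rfl⟩
    · exact Or.inl hx
    · exact Or.inr hx

theorem Att.link_hub (hL : Legs G A f c ℓ z) {i e g t : ℕ} (hei : ¬ e ≡ i [MOD c])
    (h : Att G f ℓ z i e g t) (hg : 1 ≤ g) (hg' : g ≤ ℓ i) :
    ∃ m, t + g ≤ m + 2 ∧ Link G f ℓ z i e i m := by
  obtain ⟨p, m, hp, h1, -, h⟩ := h.to_leg hL hei hg hg' le_rfl (hg.trans hg')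
  refine ⟨m, by omega, p, z i 1, hp, ?_, h.mono Set.subset_union_left⟩
  rw [← hL.zero]
  exact hL.adj i 0 (by omega)

theorem Att.link (hL : Legs G A f c ℓ z) {i e g t e' g' t' : ℕ} (hei : ¬ e ≡ i [MOD c])
    (hei' : ¬ e' ≡ i [MOD c]) (hee : ¬ e ≡ e' [MOD c])
    (h : Att G f ℓ z i e g t) (hg : 1 ≤ g) (hg' : g ≤ ℓ i)
    (h' : Att G f ℓ z i e' g' t') (hg1 : 1 ≤ g') (hg1' : g' ≤ ℓ i) :
    ∃ m, t + t' + g ≤ m + 2 + g' ∧ t + t' + g' ≤ m + 2 + g ∧ Link G f ℓ z i e e' m := by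
  obtain ⟨p, m, hp, h1, h2, h⟩ := h.to_leg hL hei hg hg' hg1 hg1'
  obtain ⟨q, n, rfl, hq, h'⟩ := h'
  refine ⟨m + n, by omega, by omega, p, q, hp, hq, (h.trans h'.symm ?_).mono ?_⟩
  · rintro x hx (rfl | hx')
    · rfl
    · rcases hx with hx | hx
      · exact absurd (leg'_subset_leg e' hx')
          (Set.disjoint_left.1 (hL.disjoint_leg hee) (leg'_subset_leg e hx))
      · exact absurd (leg'_subset_leg i hx)
          (Set.disjoint_left.1 (hL.disjoint_leg hei') (leg'_subset_leg e' hx'))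
  · rintro x (hx | rfl | hx)
    · exact Or.inl hx
    · exact Or.inl (Or.inr ⟨g', ⟨hg1, hg1'⟩, rfl⟩)
    · exact Or.inr hx

open scoped Classical in
/-- The number of neighbours of the end of leg `i` on leg `e`. -/
noncomputable def nb (G : SimpleGraph V) (ℓ : ℕ → ℕ) (z : ℕ → ℕ → V) (i e : ℕ) : ℕ :=
  ((Finset.range (ℓ e + 1)).filter fun h => G.Adj (z i (ℓ i)) (z e h)).card

open scoped Classical in
/-- The number of neighbours of `f e` on leg `i` outside the cycle. -/
noncomputable def tr (G : SimpleGraph V) (f : ℕ → V) (ℓ : ℕ → ℕ) (z : ℕ → ℕ → V) (i e : ℕ) : ℕ :=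
  ((Finset.Icc 1 (ℓ i)).filter fun g => G.Adj (f e) (z i g)).card

/-- The weight of leg `e` with respect to leg `i`. -/
noncomputable def wt (G : SimpleGraph V) (f : ℕ → V) (ℓ : ℕ → ℕ) (z : ℕ → ℕ → V) (i e : ℕ) : ℕ :=
  nb G ℓ z i e + if ℓ e = 0 then tr G f ℓ z i e else 0

theorem exists_att (hL : Legs G A f c ℓ z) {i e : ℕ} (hi : 1 ≤ ℓ i)
    (hei : ¬ e ≡ i [MOD c]) (hw : 0 < wt G f ℓ z i e) :
    ∃ t lo hi, 1 ≤ lo ∧ lo ≤ hi ∧ hi ≤ ℓ i ∧ Att G f ℓ z i e lo t ∧ Att G f ℓ z i e hi t ∧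
      wt G f ℓ z i e + lo ≤ 2 * t + hi ∧ wt G f ℓ z i e ≤ t + hi := by
  classical
  unfold wt at hw ⊢
  split_ifs at hw ⊢ with he
  · set I := (Finset.Icc 1 (ℓ i)).filter fun g => G.Adj (f e) (z i g) with hI
    have htr : tr G f ℓ z i e = I.card := by
      unfold tr; rw [hI]
    have hnb1 : nb G ℓ z i e ≤ 1 := by
      unfold nb
      exact (Finset.card_filter_le _ _).trans (by simp [he])
    have hnb2 : 0 < nb G ℓ z i e → I.Nonempty := by
      intro h
      unfold nb at h
      obtain ⟨h, hh⟩ := Finset.card_pos.1 h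
      simp only [he, Finset.mem_filter, Finset.mem_range] at hh
      have : h = 0 := by omega
      subst this
      refine ⟨ℓ i, ?_⟩
      simp only [hI, Finset.mem_filter, Finset.mem_Icc]
      refine ⟨⟨hi, le_rfl⟩, ?_⟩
      rw [← hL.zero]
      exact hh.2.symm
    have hne : I.Nonempty := by
      by_contra h
      rw [Finset.not_nonempty_iff_eq_empty] at h
      rcases Nat.eq_zero_or_pos (nb G ℓ z i e) with h0 | h0
      · rw [htr, h, h0] at hw
        simp at hw
      · simpa [h] using hnb2 h0
    have hatt : ∀ g ∈ I, 1 ≤ g ∧ g ≤ ℓ i ∧ Att G f ℓ z i e g 1 := by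
      intro g hg
      simp only [hI, Finset.mem_filter, Finset.mem_Icc] at hg
      exact ⟨hg.1.1, hg.1.2, z i g, 0, rfl, hg.2, PathOn.refl (Set.mem_insert _ _)⟩
    have hcard : I.card ≤ I.max' hne + 1 - I.min' hne := by
      rw [← Nat.card_Icc]
      refine Finset.card_le_card fun g hg => ?_
      rw [Finset.mem_Icc]
      exact ⟨I.min'_le g hg, I.le_max' g hg⟩
    have hmm := I.min'_le_max' hne
    obtain ⟨h1, h2, h3⟩ := hatt _ (I.min'_mem hne)
    obtain ⟨h4, h5, h6⟩ := hatt _ (I.max'_mem hne)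
    exact ⟨1, I.min' hne, I.max' hne, h1, hmm, h5, h3, h6, by omega, by omega⟩
  · set I := (Finset.range (ℓ e + 1)).filter fun h => G.Adj (z i (ℓ i)) (z e h) with hI
    have hnb : nb G ℓ z i e = I.card := by
      unfold nb; rw [hI]
    rw [hnb, add_zero] at hw ⊢
    have hne := Finset.card_pos.1 hw
    obtain ⟨hm, hadj⟩ := Finset.mem_filter.1 (I.max'_mem hne)
    rw [Finset.mem_range] at hm
    have hcard : I.card ≤ I.max' hne + 1 := by
      rw [← Finset.card_range (I.max' hne + 1)]
      refine Finset.card_le_card fun g hg => ?_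
      rw [Finset.mem_range]
      have := I.le_max' g hg
      omega
    have hatt : Att G f ℓ z i e (ℓ i) (I.max' hne + 1) := by
      rcases Nat.eq_zero_or_pos (I.max' hne) with h0 | h0
      · refine ⟨z i (ℓ i), 0, by rw [h0], ?_, PathOn.refl (Set.mem_insert _ _)⟩
        rw [← hL.zero]
        rw [h0] at hadj
        exact hadj.symm
      · refine ⟨z e 1, I.max' hne, rfl, ?_, ?_⟩
        · rw [← hL.zero]
          exact hL.adj e 0 (by omega)
        · have h := (hL.seg e (s := 1) h0 (by omega : _ ≤ ℓ e)).append
            (PathOn.singleton (G := G) (u := z i (ℓ i))) ?_ hadj.symm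
          · rw [add_zero, Nat.sub_add_cancel h0] at h
            refine h.mono ?_
            rintro x (⟨y, hy, rfl⟩ | rfl)
            · exact Or.inr ⟨y, ⟨hy.1, hy.2.trans (by omega)⟩, rfl⟩
            · exact Or.inl rfl
          · rw [Set.disjoint_singleton_right]
            rintro ⟨y, hy, hyx⟩
            have h1 := hy.2
            exact hei (hL.inj e y i (ℓ i) (by omega) le_rfl hyx).1
    exact ⟨_, ℓ i, ℓ i, hi, le_rfl, le_rfl, hatt, hatt, by omega, by omega⟩

end Legs

theorem Finset.exists_last {p : ℕ → Prop} {a b x : ℕ} (hx : a ≤ x) (hxb : x < b) (hp : p x) :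
    ∃ y, a ≤ y ∧ y < b ∧ p y ∧ ∀ z, y < z → z < b → ¬ p z := by
  classical
  have hne : ((Finset.Ico a b).filter p).Nonempty :=
    ⟨x, Finset.mem_filter.2 ⟨Finset.mem_Ico.2 ⟨hx, hxb⟩, hp⟩⟩
  obtain ⟨h1, h2⟩ := Finset.mem_filter.1 (Finset.max'_mem _ hne)
  rw [Finset.mem_Ico] at h1
  refine ⟨Finset.max' _ hne, h1.1, h1.2, h2, fun z hz hzb hpz => ?_⟩
  have := Finset.le_max' _ z (Finset.mem_filter.2 ⟨Finset.mem_Ico.2 ⟨h1.1.trans hz.le, hzb⟩, hpz⟩)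
  omega

theorem Finset.exists_first {p : ℕ → Prop} {a b x : ℕ} (hx : a ≤ x) (hxb : x < b) (hp : p x) :
    ∃ y, a ≤ y ∧ y < b ∧ p y ∧ ∀ z, a ≤ z → z < y → ¬ p z := by
  classical
  have hne : ((Finset.Ico a b).filter p).Nonempty :=
    ⟨x, Finset.mem_filter.2 ⟨Finset.mem_Ico.2 ⟨hx, hxb⟩, hp⟩⟩
  obtain ⟨h1, h2⟩ := Finset.mem_filter.1 (Finset.min'_mem _ hne)
  rw [Finset.mem_Ico] at h1
  refine ⟨Finset.min' _ hne, h1.1, h1.2, h2, fun z hz hzb hpz => ?_⟩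
  have := Finset.min'_le _ z
    (Finset.mem_filter.2 ⟨Finset.mem_Ico.2 ⟨hz, hzb.trans h1.2⟩, hpz⟩)
  omega

theorem Finset.sum_Ico_eq_of_last {w : ℕ → ℕ} {a b e : ℕ} (hae : a ≤ e) (heb : e < b)
    (h : ∀ z, e < z → z < b → ¬ 0 < w z) :
    ∑ x ∈ Finset.Ico a b, w x = ∑ x ∈ Finset.Ico a e, w x + w e := by
  rw [← Finset.sum_Ico_consecutive w hae heb.le, Finset.sum_eq_sum_Ico_succ_bot heb,
    Finset.sum_eq_zero (s := Finset.Ico (e + 1) b), add_zero]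
  intro x hx
  rw [Finset.mem_Ico] at hx
  have := h x (by omega) hx.2
  omega

/-- Weights of elements on a line whose mutual distances are bounded below by attachment data add
up along the line. -/
theorem chain_sum_le {w t lo hi : ℕ → ℕ} {c : ℕ}
    (h0 : ∀ d, 0 < d → d < c → 0 < w d → t d + hi d ≤ d)
    (h1 : ∀ d d', 0 < d → d < d' → d' < c → 0 < w d → 0 < w d' →
      t d + t d' + hi d' + d ≤ d' + lo d)
    (h2 : ∀ d, 0 < d → d < c → 0 < w d → w d + lo d ≤ 2 * t d + hi d)
    (d : ℕ) (hd : 0 < d) (hdc : d < c) (hw : 0 < w d) :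
    t d + hi d + ∑ e ∈ Finset.Ico 1 d, w e ≤ d := by
  induction d using Nat.strong_induction_on with
  | _ d ih =>
  by_cases h : ∃ e, 1 ≤ e ∧ e < d ∧ 0 < w e
  · obtain ⟨e', he', hed', hwe'⟩ := h
    obtain ⟨e, he, hed, hwe, hlast⟩ := Finset.exists_last (p := fun e => 0 < w e) he' hed' hwe'
    rw [Finset.sum_Ico_eq_of_last he hed hlast]
    have := ih e hed he (by omega) hwe
    have := h1 e d he hed hdc hwe hw
    have := h2 e he (by omega) hwe
    omega
  · push Not at h
    rw [Finset.sum_eq_zero, add_zero]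
    · exact h0 d hd hdc hw
    · intro e he
      rw [Finset.mem_Ico] at he
      have := h e he.1 he.2
      omega

theorem Nat.not_modEq_of_lt {c x y : ℕ} (h1 : x < y) (h2 : y < x + c) : ¬ x ≡ y [MOD c] := by
  intro h
  have := h.eq_of_lt_add h1.le h2
  omega

theorem Nat.not_modEq_of_lt' {c x y : ℕ} (h1 : x < y) (h2 : y < x + c) : ¬ y ≡ x [MOD c] :=
  fun h => Nat.not_modEq_of_lt h1 h2 h.symm

namespace Legs

variable {G : SimpleGraph V} {A : Set V} {f : ℕ → V} {c : ℕ} {ℓ : ℕ → ℕ} {z : ℕ → ℕ → V}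

theorem hub (hf : CycSeq G A f c) (hL : Legs G A f c ℓ z) {i : ℕ} (hi : 1 ≤ ℓ i) :
    (∀ d, 0 < d → d < c → 0 < wt G f ℓ z i (i + d) →
      2 ≤ d ∧ d + 2 ≤ c ∧ ∑ e ∈ Finset.Ico d c, wt G f ℓ z i (i + e) ≤ c - d) ∧
    ∀ x < c, ∑ e ∈ Finset.Ico 1 (x + 1), wt G f ℓ z i (i + e) ≤ x := by
  set w : ℕ → ℕ := fun d => wt G f ℓ z i (i + d) with hw
  have key : ∀ d, ∃ t lo hi, 0 < d → d < c → 0 < w d → 1 ≤ lo ∧ lo ≤ hi ∧ hi ≤ ℓ i ∧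
      Att G f ℓ z i (i + d) lo t ∧ Att G f ℓ z i (i + d) hi t ∧
      w d + lo ≤ 2 * t + hi ∧ w d ≤ t + hi := by
    intro d
    by_cases h : 0 < d ∧ d < c ∧ 0 < w d
    · obtain ⟨t, lo, hi', h'⟩ := hL.exists_att hi
        (Nat.not_modEq_of_lt' (by omega) (by omega) : ¬ i + d ≡ i [MOD c]) h.2.2
      exact ⟨t, lo, hi', fun _ _ _ => h'⟩
    · exact ⟨0, 0, 0, fun h1 h2 h3 => absurd ⟨h1, h2, h3⟩ h⟩
  choose t lo hi' key using key
  have h0 : ∀ d, 0 < d → d < c → 0 < w d →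
      t d + hi' d ≤ d ∧ t d + hi' d ≤ c - d ∧ 2 ≤ d ∧ d + 2 ≤ c := by
    intro d hd hdc hwd
    obtain ⟨k1, k2, k3, k4, k5, -, -⟩ := key d hd hdc hwd
    obtain ⟨m, hm, hlink⟩ := k5.link_hub hL (Nat.not_modEq_of_lt' (by omega) (by omega))
      (by omega) k3
    have g1 := hlink.symm.gap (x := i) (y := i + d) hf hL rfl rfl (by omega) (by omega)
    have g2 := hlink.gap (x := i + d) (y := i + c) hf hL rfl (by simp [Nat.ModEq]) (by omega)
      (by omega)
    omega
  have h1 : ∀ d d', 0 < d → d < d' → d' < c → 0 < w d → 0 < w d' →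
      t d + t d' + hi' d' + d ≤ d' + lo d ∧ t d + t d' + hi' d + d ≤ d' + lo d' := by
    intro d d' hd hdd hdc hwd hwd'
    obtain ⟨k1, k2, k3, k4, k5, -, -⟩ := key d hd (by omega) hwd
    obtain ⟨l1, l2, l3, l4, l5, -, -⟩ := key d' (by omega) hdc hwd'
    have e1 : ¬ i + d ≡ i [MOD c] := Nat.not_modEq_of_lt' (by omega) (by omega)
    have e2 : ¬ i + d' ≡ i [MOD c] := Nat.not_modEq_of_lt' (by omega) (by omega)
    have e3 : ¬ i + d ≡ i + d' [MOD c] := Nat.not_modEq_of_lt (by omega) (by omega)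
    obtain ⟨m, hm, hm', hl⟩ := k4.link hL e1 e2 e3 k1 (k2.trans k3) l5 (l1.trans l2) l3
    obtain ⟨n, hn, hn', hl'⟩ := k5.link hL e1 e2 e3 (k1.trans k2) k3 l4 l1 (l2.trans l3)
    have g1 := hl.gap hf hL rfl rfl (by omega : i + d < i + d') (by omega)
    have g2 := hl'.gap hf hL rfl rfl (by omega : i + d < i + d') (by omega)
    omega
  have hright : ∀ d, 0 < d → d < c → 0 < w d → w d + ∑ e ∈ Finset.Ico 1 d, w e ≤ d := by
    intro d hd hdc hwd
    have := chain_sum_le (fun d h1 h2 h3 => (h0 d h1 h2 h3).1)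
      (fun d d' a1 a2 a3 a4 a5 => (h1 d d' a1 a2 a3 a4 a5).1)
      (fun d a1 a2 a3 => (key d a1 a2 a3).2.2.2.2.2.1) d hd hdc hwd
    have := (key d hd hdc hwd).2.2.2.2.2.2
    omega
  have hleft : ∀ d, 0 < d → d < c → 0 < w d → ∑ e ∈ Finset.Ico d c, w e ≤ c - d := by
    intro d hd hdc hwd
    have h := chain_sum_le (w := fun d => w (c - d)) (t := fun d => t (c - d))
      (lo := fun d => lo (c - d)) (hi := fun d => hi' (c - d)) (c := c)
      (fun d a1 a2 a3 => by
        have := (h0 (c - d) (by omega) (by omega) a3).2.1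
        omega)
      (fun d d' a1 a2 a3 a4 a5 => by
        have := (h1 (c - d') (c - d) (by omega) (by omega) (by omega) a5 a4).2
        omega)
      (fun d a1 a2 a3 => (key (c - d) (by omega) (by omega) a3).2.2.2.2.2.1) (c - d) (by omega)
      (by omega) (by rwa [Nat.sub_sub_self hdc.le])
    rw [Finset.sum_Ico_reflect w 1 (by omega : c - d ≤ c + 1),
      show c + 1 - (c - d) = d + 1 by omega, show c + 1 - 1 = c by omega,
      Nat.sub_sub_self hdc.le] at h
    rw [Finset.sum_eq_sum_Ico_succ_bot hdc]
    have := (key d hd hdc hwd).2.2.2.2.2.2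
    omega
  refine ⟨fun d hd hdc hwd => ?_, fun x hx => ?_⟩
  · have := h0 d hd hdc hwd
    exact ⟨by omega, by omega, hleft d hd hdc hwd⟩
  · by_cases h : ∃ e, 1 ≤ e ∧ e < x + 1 ∧ 0 < w e
    · obtain ⟨e', he', hed', hwe'⟩ := h
      obtain ⟨e, he, hed, hwe, hlast⟩ := Finset.exists_last (p := fun e => 0 < w e) he' hed' hwe'
      rw [Finset.sum_Ico_eq_of_last he hed hlast]
      exact (add_comm _ _).trans_le ((hright e he (by omega) hwe).trans (by omega))
    · push Not at h
      rw [Finset.sum_eq_zero]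
      · exact Nat.zero_le _
      · intro e he
        rw [Finset.mem_Ico] at he
        exact Nat.eq_zero_of_not_pos fun hwe => absurd (h e he.1 he.2) hwe.not_ge

/-- The total weight of the legs with respect to leg `i`. -/
noncomputable def total (G : SimpleGraph V) (f : ℕ → V) (c : ℕ) (ℓ : ℕ → ℕ) (z : ℕ → ℕ → V)
    (i : ℕ) : ℕ := ∑ e ∈ Finset.Ico 1 c, wt G f ℓ z i (i + e)

theorem two_le (hf : CycSeq G A f c) (hL : Legs G A f c ℓ z) {i : ℕ} (hi : 1 ≤ ℓ i) : 2 ≤ c := by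
  by_contra h
  have := hf.pos
  have h1 : c = 1 := by omega
  refine hf.edge h1 _ (hL.mem i 0 (by omega)) _ (hL.mem i 1 hi) ?_
  exact hL.adj i 0 (by omega)

theorem total_le (hf : CycSeq G A f c) (hL : Legs G A f c ℓ z) {i : ℕ} (hi : 1 ≤ ℓ i) :
    total G f c ℓ z i + 2 ≤ c := by
  obtain ⟨h1, h2⟩ := hL.hub hf hi
  have h3 := hL.two_le hf hi
  have h4 := h2 (c - 2) (by omega)
  by_cases hw : 0 < wt G f ℓ z i (i + (c - 1))
  · have := h1 (c - 1) (by omega) (by omega) hw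
    omega
  · unfold total
    rw [← Finset.sum_Ico_consecutive _ (by omega : 1 ≤ c - 2 + 1) (by omega : c - 2 + 1 ≤ c),
      show c - 2 + 1 = c - 1 by omega, Finset.sum_eq_sum_Ico_succ_bot (by omega : c - 1 < c),
      show c - 1 + 1 = c by omega, Finset.Ico_self, Finset.sum_empty]
    rw [show c - 2 + 1 = c - 1 by omega] at h4
    omega

end Legs

namespace CycSeq

variable {G : SimpleGraph V} {A P Q S : Set V} {f : ℕ → V} {c : ℕ}

theorem disjoint_arc (hf : CycSeq G A f c) {x y x' y' : ℕ} (hyx : y < x')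
    (hy' : y' < x + c) : Disjoint (f '' Set.Icc x y) (f '' Set.Icc x' y') := by
  rw [Set.disjoint_left]
  rintro _ ⟨s, hs, rfl⟩ ⟨t, ht, hst⟩
  have h1 := hs.1
  have h2 := hs.2
  have h3 := ht.1
  have h4 := ht.2
  exact Nat.not_modEq_of_lt' (by omega) (by omega) (hf.inj _ _ hst)

theorem disjoint_arc_of_inter {x y b : ℕ} (hQ : ∀ u ∈ Q, u ∈ Set.range f → u = f b)
    (hb : f b ∉ f '' Set.Icc x y) : Disjoint (f '' Set.Icc x y) Q := by
  rw [Set.disjoint_left]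
  intro u hu hu'
  have := hQ u hu' (Set.image_subset_range _ _ hu)
  subst this
  exact hb hu

theorem notMem_arc (hf : CycSeq G A f c) {x y b : ℕ} (hyb : y < b) (hbx : b < x + c) :
    f b ∉ f '' Set.Icc x y := by
  rintro ⟨s, hs, h⟩
  have h1 := hs.1
  have h2 := hs.2
  exact Nat.not_modEq_of_lt (by omega) (by omega) (hf.inj _ _ h)

theorem notMem_arc' (hf : CycSeq G A f c) {x y b : ℕ} (hbx : b < x) (hyb : y < b + c) :
    f b ∉ f '' Set.Icc x y := by
  rintro ⟨s, hs, h⟩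
  have h1 := hs.1
  have h2 := hs.2
  exact Nat.not_modEq_of_lt' (by omega) (by omega) (hf.inj _ _ h)

theorem arc_append (hf : CycSeq G A f c) {x y n : ℕ} {q : V} (hxy : x ≤ y) (hyx : y < x + c)
    (hQ : PathOn G Q (f y) q n) (hQf : ∀ u ∈ Q, u ∈ Set.range f → u = f y) :
    PathOn G (f '' Set.Icc x y ∪ Q) (f x) q (y - x + n) :=
  (hf.arc hxy hyx).trans hQ fun u hu hu' => hQf u hu' (Set.image_subset_range _ _ hu)

theorem arc_append' (hf : CycSeq G A f c) {x y n : ℕ} {q : V} (hxy : x ≤ y) (hyx : y < x + c)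
    (hQ : PathOn G Q (f x) q n) (hQf : ∀ u ∈ Q, u ∈ Set.range f → u = f x) :
    PathOn G (f '' Set.Icc x y ∪ Q) (f y) q (y - x + n) :=
  (hf.arc hxy hyx).symm.trans hQ fun u hu hu' => hQf u hu' (Set.image_subset_range _ _ hu)

theorem image_subset (hf : CycSeq G A f c) (s : Set ℕ) : f '' s ⊆ A := by
  rintro _ ⟨x, -, rfl⟩
  exact hf.mem x

/-- Two tails attached to the ends of an arc. -/
theorem direct (hf : CycSeq G A f c) {x y m n : ℕ} {p q : V} (hxy : x < y) (hyx : y < x + c)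
    (hP : PathOn G P (f x) p m) (hPf : ∀ u ∈ P, u ∈ Set.range f → u = f x) (hPA : P ⊆ A)
    (hQ : PathOn G Q (f y) q n) (hQf : ∀ u ∈ Q, u ∈ Set.range f → u = f y) (hQA : Q ⊆ A)
    (hPQ : Disjoint P Q) : ∃ k, y - x ≤ k ∧ PathOn G A p q k ∧ PathOn G A q p k := by
  have h := hP.symm.trans (hf.arc_append hxy.le hyx hQ hQf) ?_
  · have h' := h.mono (Set.union_subset hPA (Set.union_subset (hf.image_subset _) hQA))
    exact ⟨_, by omega, h', h'.symm⟩
  · rintro u hu (hu' | hu')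
    · exact hPf u hu (Set.image_subset_range _ _ hu')
    · exact absurd hu' (Set.disjoint_left.1 hPQ hu)

/-- Two tails attached to disjoint arcs, which are joined by a path off the cycle. -/
theorem detour (hf : CycSeq G A f c) {v b e a m k n : ℕ} {p q p' q' : V} (hvb : v ≤ b)
    (hbe : b < e) (hea : e ≤ a) (hav : a < v + c)
    (hP : PathOn G P (f a) p m) (hPf : ∀ u ∈ P, u ∈ Set.range f → u = f a) (hPA : P ⊆ A)
    (hQ : PathOn G Q (f b) q n) (hQf : ∀ u ∈ Q, u ∈ Set.range f → u = f b) (hQA : Q ⊆ A)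
    (hS : PathOn G S p' q' k) (hSf : Disjoint S (Set.range f)) (hSA : S ⊆ A)
    (hp : G.Adj (f e) p') (hq : G.Adj (f v) q')
    (hPQ : Disjoint P Q) (hPS : Disjoint P S) (hQS : Disjoint Q S) :
    ∃ l, (a - e) + 2 + (b - v) ≤ l ∧ PathOn G A p q l := by
  have h1 := hf.arc_append hea (by omega) hP hPf
  have h2 := hf.arc_append hvb (by omega) hQ hQf
  have d1 : Disjoint (f '' Set.Icc e a ∪ P) S := by
    rw [Set.disjoint_union_left]
    exact ⟨(hSf.mono_right (Set.image_subset_range _ _)).symm, hPS⟩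
  have d2 : Disjoint (f '' Set.Icc v b ∪ Q) S := by
    rw [Set.disjoint_union_left]
    exact ⟨(hSf.mono_right (Set.image_subset_range _ _)).symm, hQS⟩
  have d3 : Disjoint (f '' Set.Icc e a ∪ P) (f '' Set.Icc v b ∪ Q) := by
    simp only [Set.disjoint_union_left, Set.disjoint_union_right]
    refine ⟨⟨(hf.disjoint_arc hbe hav).symm,
      (disjoint_arc_of_inter hPf (hf.notMem_arc (by omega) hav)).symm⟩,
      disjoint_arc_of_inter hQf (hf.notMem_arc' hbe (by omega)), hPQ⟩
  have h3 := (h1.symm.append hS d1 hp).append h2 ?_ hq.symm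
  · refine ⟨_, by omega, h3.mono ?_⟩
    simp only [Set.union_subset_iff]
    exact ⟨⟨⟨hf.image_subset _, hPA⟩, hSA⟩, hf.image_subset _, hQA⟩
  · rw [Set.disjoint_union_left]
    exact ⟨d3, d2.symm⟩

/-- A tail attached to an arc, which is continued by a path off the cycle. -/
theorem exit (hf : CycSeq G A f c) {x y m k : ℕ} {p p' q : V} (hxy : x ≤ y) (hyx : y < x + c)
    (hP : PathOn G P (f y) p m) (hPf : ∀ u ∈ P, u ∈ Set.range f → u = f y) (hPA : P ⊆ A)
    (hS : PathOn G S p' q k) (hSf : Disjoint S (Set.range f)) (hSA : S ⊆ A)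
    (hp : G.Adj (f x) p') (hPS : Disjoint P S) :
    ∃ l, y - x + k + 1 ≤ l ∧ PathOn G A p q l := by
  have h := (hf.arc_append hxy hyx hP hPf).symm.append hS ?_ hp
  · refine ⟨_, by omega, h.mono ?_⟩
    simp only [Set.union_subset_iff]
    exact ⟨⟨hf.image_subset _, hPA⟩, hSA⟩
  · rw [Set.disjoint_union_left]
    exact ⟨(hSf.mono_right (Set.image_subset_range _ _)).symm, hPS⟩

theorem exit' (hf : CycSeq G A f c) {x y m k : ℕ} {p p' q : V} (hxy : x ≤ y) (hyx : y < x + c)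
    (hP : PathOn G P (f x) p m) (hPf : ∀ u ∈ P, u ∈ Set.range f → u = f x) (hPA : P ⊆ A)
    (hS : PathOn G S p' q k) (hSf : Disjoint S (Set.range f)) (hSA : S ⊆ A)
    (hp : G.Adj (f y) p') (hPS : Disjoint P S) :
    ∃ l, y - x + k + 1 ≤ l ∧ PathOn G A p q l := by
  have h := (hf.arc_append' hxy hyx hP hPf).symm.append hS ?_ hp
  · refine ⟨_, by omega, h.mono ?_⟩
    simp only [Set.union_subset_iff]
    exact ⟨⟨hf.image_subset _, hPA⟩, hSA⟩
  · rw [Set.disjoint_union_left]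
    exact ⟨(hSf.mono_right (Set.image_subset_range _ _)).symm, hPS⟩

end CycSeq

namespace Legs

variable {G : SimpleGraph V} {A : Set V} {f : ℕ → V} {c : ℕ} {ℓ : ℕ → ℕ} {z : ℕ → ℕ → V}

theorem leg_inter (h : Legs G A f c ℓ z) {i : ℕ} : ∀ u ∈ leg ℓ z i, u ∈ Set.range f → u = f i := by
  rintro _ ⟨t, ht, rfl⟩ ⟨j, hj⟩
  rw [← h.zero] at hj
  have := (h.inj j 0 i t (by omega) ht.2 hj).2
  rw [← this, h.zero]

theorem leg_eq (h : Legs G A f c ℓ z) {i j : ℕ} (hij : i ≡ j [MOD c]) :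
    leg ℓ z i = leg ℓ z j := by
  unfold leg
  rw [h.eq hij, h.len_eq hij]

theorem up (h : Legs G A f c ℓ z) {i : ℕ} {p : V} (hp : p ∈ leg ℓ z i) :
    ∃ m, PathOn G (leg ℓ z i) (f i) p m := by
  obtain ⟨m, hm⟩ := h.down hp
  exact ⟨m, hm.symm⟩

theorem leg'_eq_empty {i : ℕ} (hi : ℓ i = 0) : leg' ℓ z i = ∅ := by
  unfold leg'
  rw [hi]
  simp

theorem start_mem_leg (h : Legs G A f c ℓ z) (i : ℕ) : f i ∈ leg ℓ z i :=
  ⟨0, by simp, h.zero i⟩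

/-- Any vertex of leg `a` is joined to any vertex of leg `b` by a path in `A` with at least `x`
edges. -/
def Long (G : SimpleGraph V) (A : Set V) (ℓ : ℕ → ℕ) (z : ℕ → ℕ → V) (a b x : ℕ) : Prop :=
  ∀ p ∈ leg ℓ z a, ∀ q ∈ leg ℓ z b, ∃ n, x ≤ n ∧ PathOn G A p q n

theorem Long.congr (h : Legs G A f c ℓ z) {a b a' b' x : ℕ} (ha : a ≡ a' [MOD c])
    (hb : b ≡ b' [MOD c]) (hl : Long G A ℓ z a b x) : Long G A ℓ z a' b' x := by
  unfold Long at hl ⊢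
  rwa [← h.leg_eq ha, ← h.leg_eq hb]

theorem long_of_lt (hf : CycSeq G A f c) (h : Legs G A f c ℓ z) {a b : ℕ} (hab : a < b)
    (hba : b < a + c) : Long G A ℓ z a b (b - a) ∧ Long G A ℓ z b a (b - a) := by
  have hd := h.disjoint_leg (Nat.not_modEq_of_lt hab hba)
  constructor
  · intro p hp q hq
    obtain ⟨m, hm⟩ := h.up hp
    obtain ⟨n, hn⟩ := h.up hq
    obtain ⟨k, hk, hk', -⟩ := hf.direct hab hba hm h.leg_inter (h.leg_subset _) hn
      h.leg_inter (h.leg_subset _) hd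
    exact ⟨k, hk, hk'⟩
  · intro q hq p hp
    obtain ⟨m, hm⟩ := h.up hp
    obtain ⟨n, hn⟩ := h.up hq
    obtain ⟨k, hk, -, hk'⟩ := hf.direct hab hba hm h.leg_inter (h.leg_subset _) hn
      h.leg_inter (h.leg_subset _) hd
    exact ⟨k, hk, hk'⟩

end Legs

namespace Legs

variable {G : SimpleGraph V} {A : Set V} {f : ℕ → V} {c : ℕ} {ℓ : ℕ → ℕ} {z : ℕ → ℕ → V}

theorem sum_eq_of_first {w : ℕ → ℕ} {x e c : ℕ} (hxe : x + 1 ≤ e) (hec : e < c)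
    (h : ∀ y, x + 1 ≤ y → y < e → ¬ 0 < w y) :
    (Finset.Ico 1 c).sum w = (Finset.Ico 1 (x + 1)).sum w + (Finset.Ico e c).sum w := by
  rw [← Finset.sum_Ico_consecutive w (by omega : 1 ≤ x + 1) (by omega : x + 1 ≤ c),
    ← Finset.sum_Ico_consecutive w hxe hec.le, Finset.sum_eq_zero (s := Finset.Ico (x + 1) e),
    zero_add]
  intro y hy
  rw [Finset.mem_Ico] at hy
  exact Nat.eq_zero_of_not_pos (h y hy.1 hy.2)

theorem long_total (hf : CycSeq G A f c) (hL : Legs G A f c ℓ z) {i dv db a : ℕ} (hi : 1 ≤ ℓ i)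
    (hdv : dv < c) (hdb : db < c) (ha : a + 1 = i + dv + c) (hab : ¬ a ≡ i + db [MOD c])
    (hv : dv = 0 ∨ 0 < dv ∧ ℓ (i + dv) = 0 ∧ 0 < wt G f ℓ z i (i + dv)) :
    Long G A ℓ z a (i + db) (total G f c ℓ z i) := by
  obtain ⟨H1, H2⟩ := hL.hub hf hi
  have htot := hL.total_le hf hi
  unfold total at htot ⊢
  set w : ℕ → ℕ := fun d => wt G f ℓ z i (i + d) with hw
  have hmod : ∀ x, i + x + c ≡ i + x [MOD c] := fun x => by simp [Nat.ModEq]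
  have hab1 : dv ≠ db + 1 := by
    rintro rfl
    apply hab
    rw [show a = i + db + c by omega]
    exact hmod db
  have hab2 : dv = 0 → db + 1 ≠ c := by
    rintro rfl h
    apply hab
    rw [show a = i + db by omega]
  have hai : ¬ a ≡ i [MOD c] := by
    rcases hv with rfl | hv
    · exact Nat.not_modEq_of_lt' (by omega) (by omega)
    · have := H1 dv hv.1 hdv hv.2.2
      intro h
      exact Nat.not_modEq_of_lt' (x := i + c) (y := a) (by omega) (by omega)
        (h.trans (hmod 0).symm)
  have hav : ¬ a ≡ i + dv [MOD c] := Nat.not_modEq_of_lt' (by omega) (by omega)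
  have hne : ∀ e, 0 < e → e < c → ¬ i + e ≡ i [MOD c] := fun e h1 h2 =>
    Nat.not_modEq_of_lt' (by omega) (by omega)
  have hlink : ∀ e, e < c → e ≠ dv → (e = 0 ∨ 0 < e ∧ 0 < w e) →
      ∃ k, Link G f ℓ z i (i + e) (i + dv) k := by
    rintro e hec hev (rfl | ⟨he, hwe⟩)
    · rcases hv with rfl | hv
      · exact absurd rfl hev
      · obtain ⟨t, lo, hi', h1, h2, h3, h4, -⟩ := hL.exists_att hi (hne dv hv.1 hdv) hv.2.2
        obtain ⟨k, -, hk⟩ := h4.link_hub hL (hne dv hv.1 hdv) h1 (h2.trans h3)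
        exact ⟨k, hk.symm⟩
    · obtain ⟨t, lo, hi', h1, h2, h3, h4, -⟩ := hL.exists_att hi (hne e he hec) hwe
      rcases hv with rfl | hv
      · obtain ⟨k, -, hk⟩ := h4.link_hub hL (hne e he hec) h1 (h2.trans h3)
        exact ⟨k, hk⟩
      · obtain ⟨t', lo', hi'', h1', h2', h3', h4', -⟩ :=
          hL.exists_att hi (hne dv hv.1 hdv) hv.2.2
        have : ¬ i + e ≡ i + dv [MOD c] := by
          rcases lt_or_gt_of_ne hev with h | h
          · exact Nat.not_modEq_of_lt (by omega) (by omega)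
          · exact Nat.not_modEq_of_lt' (by omega) (by omega)
        obtain ⟨k, -, -, hk⟩ := h4.link hL (hne e he hec) (hne dv hv.1 hdv) this h1 (h2.trans h3)
          h4' h1' (h2'.trans h3')
        exact ⟨k, hk⟩
  intro p hp q hq
  obtain ⟨np, hP⟩ := hL.up hp
  have hdisj : ∀ {x y : ℕ}, ¬ x ≡ y [MOD c] → Disjoint (leg ℓ z x) (leg' ℓ z y) :=
    fun h => (hL.disjoint_leg h).mono_right (leg'_subset_leg _)
  by_cases hq' : db = 0 ∧ q ≠ f i
  · obtain ⟨rfl, hqf⟩ := hq'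
    obtain ⟨s, hs, rfl⟩ := hq
    rw [add_zero] at hqf hs ⊢
    have hs1 : 1 ≤ s := by
      rw [Nat.one_le_iff_ne_zero]
      rintro rfl
      exact hqf (hL.zero i)
    rcases hv with rfl | hv
    · by_cases h : ∃ e, 1 ≤ e ∧ e < c ∧ 0 < w e
      · obtain ⟨e', he', hed', hwe'⟩ := h
        obtain ⟨e, he, hec, hwe, hlast⟩ :=
          Finset.exists_last (p := fun e => 0 < w e) he' hed' hwe'
        have hT : (Finset.Ico 1 c).sum w ≤ e := by
          rw [Finset.sum_Ico_eq_of_last he hec hlast]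
          have := H2 e hec
          rwa [Finset.sum_Ico_succ_top he] at this
        have he2 := H1 e he hec hwe
        obtain ⟨t, lo, hi', h1, h2, h3, h4, -⟩ := hL.exists_att hi (hne e he hec) hwe
        obtain ⟨p', m, hp', -, -, hS⟩ := h4.to_leg hL (hne e he hec) h1 (h2.trans h3) hs1 hs.2
        rw [← hf.eq_of_modEq (hmod e)] at hp'
        obtain ⟨l, hl, hl'⟩ := hf.exit' (x := a) (y := i + e + c) (by omega) (by omega) hP
          hL.leg_inter (hL.leg_subset _) hS
          (by rw [Set.disjoint_union_left]; exact ⟨hL.disjoint_leg' _, hL.disjoint_leg' _⟩)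
          (Set.union_subset (hL.leg'_subset _) (hL.leg'_subset _)) hp'
          (by
            rw [Set.disjoint_union_right]
            exact ⟨hdisj (Nat.not_modEq_of_lt' (by omega) (by omega)), hdisj hai⟩)
        exact ⟨l, by omega, hl'⟩
      · push Not at h
        rw [Finset.sum_eq_zero (fun e he => by
          rw [Finset.mem_Ico] at he
          exact Nat.eq_zero_of_not_pos fun hwe => absurd (h e he.1 he.2) hwe.not_ge)]
        have hl := (hL.long_of_lt hf (Nat.lt_succ_self a) (by omega)).1
        obtain ⟨n, -, hn⟩ := hl p hp (z i s) (by
          rw [hL.leg_eq (show a + 1 ≡ i [MOD c] by rw [ha]; exact hmod 0)]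
          exact ⟨s, hs, rfl⟩)
        exact ⟨n, Nat.zero_le _, hn⟩
    · obtain ⟨t, lo, hi', h1, h2, h3, h4, -⟩ := hL.exists_att hi (hne dv hv.1 hdv) hv.2.2
      obtain ⟨p', m, hp', -, -, hS⟩ := h4.to_leg hL (hne dv hv.1 hdv) h1 (h2.trans h3) hs1 hs.2
      obtain ⟨l, hl, hl'⟩ := hf.exit (x := i + dv) (y := a) (by omega) (by omega) hP
        hL.leg_inter (hL.leg_subset _) hS
        (by rw [Set.disjoint_union_left]; exact ⟨hL.disjoint_leg' _, hL.disjoint_leg' _⟩)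
        (Set.union_subset (hL.leg'_subset _) (hL.leg'_subset _)) hp'
        (by
          rw [Set.disjoint_union_right]
          exact ⟨hdisj hav, hdisj hai⟩)
      exact ⟨l, by omega, hl'⟩
  obtain ⟨Q, nq, hQ, hQf, hQA, hPQ, hQi, hQv, hQe⟩ : ∃ (Q : Set V) (nq : ℕ),
      PathOn G Q (f (i + db)) q nq ∧ (∀ u ∈ Q, u ∈ Set.range f → u = f (i + db)) ∧ Q ⊆ A ∧
      Disjoint (leg ℓ z a) Q ∧ Disjoint Q (leg' ℓ z i) ∧ Disjoint Q (leg' ℓ z (i + dv)) ∧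
      ∀ e, ¬ i + db ≡ e [MOD c] → Disjoint Q (leg' ℓ z e) := by
    by_cases h0 : db = 0
    · have hqf : q = f i := by
        by_contra h
        exact hq' ⟨h0, h⟩
      subst h0 hqf
      have hd : ∀ e, Disjoint {f i} (leg' ℓ z e) := by
        intro e
        rw [Set.disjoint_singleton_left]
        exact fun h => Set.disjoint_left.1 (hL.disjoint_leg' e) h ⟨i, rfl⟩
      refine ⟨{f i}, 0, PathOn.singleton, fun u hu _ => hu, ?_, ?_, hd _, hd _,
        fun e _ => hd e⟩
      · rw [Set.singleton_subset_iff]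
        exact hf.mem i
      · exact (hL.disjoint_leg hab).mono_right (Set.singleton_subset_iff.2 (hL.start_mem_leg i))
    · obtain ⟨nq, hQ⟩ := hL.up hq
      have hQi := hdisj (hne db (Nat.pos_of_ne_zero h0) hdb)
      refine ⟨_, nq, hQ, hL.leg_inter, hL.leg_subset _, hL.disjoint_leg hab, hQi, ?_,
        fun e he => hdisj he⟩
      rcases hv with rfl | hv
      · exact hQi
      · rw [leg'_eq_empty hv.2.1]
        exact Set.disjoint_empty _
  have hfin : ∀ e B' E', e < c → (e = 0 ∨ 0 < e ∧ 0 < w e) → B' ≡ i + db [MOD c] →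
      E' ≡ i + e [MOD c] → i + dv ≤ B' → B' < E' → E' < a →
      ∃ n, (a - E') + 2 + (B' - (i + dv)) ≤ n ∧ PathOn G A p q n := by
    intro e B' E' hec he hB hE h1 h2 h3
    have hev : e ≠ dv := by
      rintro rfl
      exact Nat.not_modEq_of_lt' (by omega) (by omega) hE
    obtain ⟨k, p', q', hp', hq', hS⟩ := hlink e hec hev he
    rw [← hf.eq_of_modEq hE] at hp'
    rw [← hf.eq_of_modEq hB] at hQ hQf
    have hbe : ¬ i + db ≡ i + e [MOD c] := fun h =>
      Nat.not_modEq_of_lt h2 (by omega) ((hB.trans h).trans hE.symm)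
    have hae : ¬ a ≡ i + e [MOD c] := fun h =>
      Nat.not_modEq_of_lt' h3 (by omega) (h.trans hE.symm)
    refine hf.detour h1 h2 h3.le (by omega) hP hL.leg_inter (hL.leg_subset _) hQ hQf hQA hS
      ?_ ?_ hp' hq' hPQ ?_ ?_
    · simp only [Set.disjoint_union_left]
      exact ⟨⟨hL.disjoint_leg' _, hL.disjoint_leg' _⟩, hL.disjoint_leg' _⟩
    · simp only [Set.union_subset_iff]
      exact ⟨⟨hL.leg'_subset _, hL.leg'_subset _⟩, hL.leg'_subset _⟩
    · simp only [Set.disjoint_union_right]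
      exact ⟨⟨hdisj hae, hdisj hai⟩, hdisj hav⟩
    · simp only [Set.disjoint_union_right]
      exact ⟨⟨hQe _ hbe, hQi⟩, hQv⟩
  have hdirect : ∀ y, a < y → y < a + c → y ≡ i + db [MOD c] →
      ∃ n, y - a ≤ n ∧ PathOn G A p q n := by
    intro y h1 h2 h3
    exact ((hL.long_of_lt hf h1 h2).1.congr hL rfl h3) p hp q hq
  have H2db := H2 db hdb
  rcases le_or_gt dv db with hvb | hvb
  · by_cases h : ∃ e, db + 1 ≤ e ∧ e < c ∧ 0 < w e
    · obtain ⟨e', he', hed', hwe'⟩ := h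
      obtain ⟨e, he, hec, hwe, hfirst⟩ :=
        Finset.exists_first (p := fun e => 0 < w e) he' hed' hwe'
      rw [sum_eq_of_first he hec hfirst]
      have h1 := H1 e (by omega) hec hwe
      obtain ⟨n, hn, hn'⟩ := hfin e (i + db) (i + e) hec (Or.inr ⟨by omega, hwe⟩) rfl rfl
        (by omega) (by omega) (by omega)
      exact ⟨n, by omega, hn'⟩
    · push Not at h
      have hT : (Finset.Ico 1 c).sum w ≤ db := by
        rw [← Finset.sum_Ico_consecutive w (by omega : 1 ≤ db + 1) (by omega : db + 1 ≤ c),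
          Finset.sum_eq_zero (s := Finset.Ico (db + 1) c)]
        · exact H2db
        · intro e he
          rw [Finset.mem_Ico] at he
          exact Nat.eq_zero_of_not_pos fun hwe => absurd (h e he.1 he.2) hwe.not_ge
      rcases hv with rfl | hv
      · have := hab2 rfl
        obtain ⟨n, hn, hn'⟩ := hdirect (i + db + c) (by omega) (by omega) (hmod db)
        exact ⟨n, by omega, hn'⟩
      · have := H1 dv hv.1 hdv hv.2.2
        obtain ⟨n, hn, hn'⟩ := hfin 0 (i + db) (i + 0 + c) (by omega) (Or.inl rfl) rfl (hmod 0)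
          (by omega) (by omega) (by omega)
        exact ⟨n, by omega, hn'⟩
  · have hv' := hv.resolve_left (by omega)
    by_cases h : ∃ e, db + 1 ≤ e ∧ e < dv ∧ 0 < w e
    · obtain ⟨e', he', hed', hwe'⟩ := h
      obtain ⟨e, he, hec, hwe, hfirst⟩ :=
        Finset.exists_first (p := fun e => 0 < w e) he' hed' hwe'
      rw [sum_eq_of_first he (by omega) hfirst]
      have h1 := H1 e (by omega) (by omega) hwe
      obtain ⟨k, hk⟩ := hlink e (by omega) (by omega) (Or.inr ⟨by omega, hwe⟩)
      have h2 := hk.gap hf hL rfl rfl (by omega : i + e < i + dv) (by omega)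
      obtain ⟨n, hn, hn'⟩ := hfin e (i + db + c) (i + e + c) (by omega)
        (Or.inr ⟨by omega, hwe⟩) (hmod _) (hmod _) (by omega) (by omega) (by omega)
      exact ⟨n, by omega, hn'⟩
    · push Not at h
      rw [sum_eq_of_first (by omega : db + 1 ≤ dv) hdv
        (fun y h1 h2 h3 => absurd (h y h1 h2) h3.not_ge)]
      have h1 := H1 dv hv'.1 hdv hv'.2.2
      have := hmod (db + c)
      obtain ⟨n, hn, hn'⟩ := hdirect (i + (db + c) + c) (by omega) (by omega)
        ((hmod _).trans (by rw [← add_assoc]; exact hmod db))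
      exact ⟨n, by omega, hn'⟩

end Legs

open scoped Classical in
/-- The number of neighbours of `y` on the cycle of length `N` described by `g`. -/
noncomputable def phi (G : SimpleGraph V) (g : ℕ → V) (N : ℕ) (y : V) : ℕ :=
  ((Finset.range N).filter fun x => G.Adj (g x) y).card

theorem Function.Periodic.sum_range_add {w : ℕ → ℕ} {c : ℕ} (hw : Function.Periodic w c) (i : ℕ) :
    ∑ d ∈ Finset.range c, w (i + d) = ∑ d ∈ Finset.range c, w d := by
  induction i with
  | zero => simp
  | succ i ih =>
    rw [← ih]
    have h1 := Finset.sum_range_succ (fun d => w (i + d)) c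
    have h2 := Finset.sum_range_succ' (fun d => w (i + d)) c
    have h3 := hw i
    simp only [add_zero, ← add_assoc] at h1 h2
    simp only [add_right_comm i 1]
    omega

theorem Function.Periodic.sum_Ico_add {w : ℕ → ℕ} {c : ℕ} (hw : Function.Periodic w c) {i : ℕ}
    (hi : i < c) : ∑ d ∈ Finset.Ico 1 c, w (i + d) = ∑ e ∈ (Finset.range c).erase i, w e := by
  have h1 := hw.sum_range_add i
  rw [Finset.range_eq_Ico, Finset.sum_eq_sum_Ico_succ_bot (by omega), ← Finset.range_eq_Ico,
    ← Finset.add_sum_erase _ _ (Finset.mem_range.2 hi)] at h1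
  simpa using h1

namespace CycSeq

variable {G : SimpleGraph V} {A : Set V} {f : ℕ → V} {c : ℕ}

theorem mem_range_iff (hf : CycSeq G A f c) {x : V} :
    x ∈ Set.range f ↔ ∃ i < c, f i = x := by
  constructor
  · rintro ⟨i, rfl⟩
    exact ⟨i % c, Nat.mod_lt _ hf.pos, hf.eq_of_modEq (Nat.mod_modEq _ _)⟩
  · rintro ⟨i, -, rfl⟩
    exact ⟨i, rfl⟩

theorem phi_add_one_le {v : ℕ} (hv : v < c) : phi G f c (f v) + 1 ≤ c := by
  classical
  unfold phi
  have h : ((Finset.range c).filter fun x => G.Adj (f x) (f v)) ⊆ (Finset.range c).erase v := by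
    intro x hx
    rw [Finset.mem_filter] at hx
    refine Finset.mem_erase.2 ⟨?_, hx.1⟩
    rintro rfl
    exact G.loopless.irrefl _ hx.2
  have := Finset.card_le_card h
  rw [Finset.card_erase_of_mem (Finset.mem_range.2 hv), Finset.card_range] at this
  omega

end CycSeq

namespace Legs

variable {G : SimpleGraph V} {A : Set V} {f g : ℕ → V} {c N : ℕ} {ℓ : ℕ → ℕ} {z : ℕ → ℕ → V}

theorem wt_periodic (hf : CycSeq G A f c) (hL : Legs G A f c ℓ z) (i : ℕ) :
    Function.Periodic (wt G f ℓ z i) c := by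
  intro e
  have h1 : z (e + c) = z e := funext (hL.per e)
  unfold wt nb tr
  rw [hL.per_len, hf.per, h1]

theorem total_eq (hf : CycSeq G A f c) (hL : Legs G A f c ℓ z) {i : ℕ} (hi : i < c) :
    total G f c ℓ z i = ∑ e ∈ (Finset.range c).erase i, wt G f ℓ z i e :=
  (hL.wt_periodic hf i).sum_Ico_add hi

theorem tr_eq_zero {i : ℕ} (hi : ℓ i = 0) (e : ℕ) : tr G f ℓ z i e = 0 := by
  simp [tr, hi]

theorem degree_le (hL : Legs G A f c ℓ z) (hc : 0 < c) (hs : Saturated G A ℓ z)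
    (hgA : ∀ x ∉ A, ∃ j < N, g j = x) {d : ℕ}
    (hd : ∀ x, d ≤ (G.neighborSet x).ncard) (i : ℕ) :
    d ≤ phi G g N (z i (ℓ i)) + ∑ e ∈ Finset.range c, nb G ℓ z i e := by
  classical
  refine (hd (z i (ℓ i))).trans ?_
  set F : Finset V := (((Finset.range N).filter fun x => G.Adj (g x) (z i (ℓ i))).image g) ∪
    (Finset.range c).biUnion fun e =>
      ((Finset.range (ℓ e + 1)).filter fun h => G.Adj (z i (ℓ i)) (z e h)).image (z e) with hF
  have hsub : G.neighborSet (z i (ℓ i)) ⊆ (F : Set V) := by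
    intro x hx
    rw [Finset.mem_coe, hF, Finset.mem_union]
    rw [mem_neighborSet] at hx
    by_cases hxA : x ∈ A
    · right
      obtain ⟨j, t, ht, rfl⟩ := hs i x hxA hx
      rw [Finset.mem_biUnion]
      have hj := Nat.mod_modEq j c
      refine ⟨j % c, Finset.mem_range.2 (Nat.mod_lt _ hc), Finset.mem_image.2 ⟨t, ?_, ?_⟩⟩
      · rw [Finset.mem_filter, Finset.mem_range, hL.len_eq hj, hL.eq hj]
        exact ⟨by omega, hx⟩
      · rw [hL.eq hj]
    · left
      obtain ⟨j, hj, rfl⟩ := hgA x hxA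
      exact Finset.mem_image.2 ⟨j, Finset.mem_filter.2 ⟨Finset.mem_range.2 hj, hx.symm⟩, rfl⟩
  have h1 := Set.ncard_le_ncard hsub (Finset.finite_toSet F)
  rw [Set.ncard_coe_finset] at h1
  refine h1.trans ((Finset.card_union_le _ _).trans (Nat.add_le_add Finset.card_image_le
    (Finset.card_biUnion_le.trans (Finset.sum_le_sum fun e _ => ?_))))
  refine Finset.card_image_le.trans (le_of_eq ?_)
  rfl

theorem nb_self_le (i : ℕ) : nb G ℓ z i i ≤ ℓ i := by
  classical
  unfold nb
  rw [Finset.range_add_one, Finset.filter_insert, if_neg (G.loopless.irrefl _)]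
  exact (Finset.card_filter_le _ _).trans (Finset.card_range _).le

theorem nb_self_add_one_le (hL : Legs G A f c ℓ z) {K : ℕ}
    (hK : ∀ (y : V) (w : G.Walk y y), w.IsCycle → (∀ x ∈ w.support, x ∈ A) → w.length ≤ K)
    {i : ℕ} (h2 : 2 ≤ nb G ℓ z i i) : nb G ℓ z i i + 1 ≤ K := by
  classical
  set F := (Finset.range (ℓ i + 1)).filter fun h => G.Adj (z i (ℓ i)) (z i h) with hF
  have hcard : nb G ℓ z i i = F.card := by
    unfold nb; rw [hF]
  have hne : F.Nonempty := Finset.card_pos.1 (by omega)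
  obtain ⟨h1, hadj⟩ := Finset.mem_filter.1 (Finset.min'_mem F hne)
  set m := F.min' hne with hm
  rw [Finset.mem_range] at h1
  have hsub : F ⊆ Finset.Ico m (ℓ i) := by
    intro x hx
    obtain ⟨hx1, hx2⟩ := Finset.mem_filter.1 hx
    rw [Finset.mem_range] at hx1
    refine Finset.mem_Ico.2 ⟨Finset.min'_le _ _ hx, ?_⟩
    refine lt_of_le_of_ne (by omega) ?_
    rintro rfl
    exact G.loopless.irrefl _ hx2
  have h3 := Finset.card_le_card hsub
  rw [Nat.card_Ico] at h3
  have hpath := hL.seg i (s := m) (t := ℓ i - 1) (by omega) (by omega)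
  obtain ⟨y, w, hw, hl, hws⟩ := hpath.isCycle (PathOn.singleton (G := G) (u := z i (ℓ i)))
    (by
      rw [Set.disjoint_singleton_right]
      rintro ⟨t, ht, h⟩
      have := (hL.inj i t i (ℓ i) (by have := ht.2; omega) le_rfl h).2
      have := ht.2
      omega)
    (by
      have := hL.adj i (ℓ i - 1) (by omega)
      rwa [Nat.sub_add_cancel (by omega)] at this) hadj (by omega)
  have := hK y w hw (by
    intro x hx
    rcases hws x hx with ⟨t, ht, rfl⟩ | rfl
    · exact hL.mem i t (by have := ht.2; omega)
    · exact hL.mem i _ le_rfl)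
  omega

theorem nb_self_le' (hf : CycSeq G A f c) (hL : Legs G A f c ℓ z) (i : ℕ) :
    nb G ℓ z i i ≤ c + 1 := by
  by_contra h
  have := hL.nb_self_add_one_le hf.max (i := i) (by have := hf.pos; omega)
  omega

theorem degree_le_of_pos (hf : CycSeq G A f c) (hL : Legs G A f c ℓ z) (hs : Saturated G A ℓ z)
    (hgA : ∀ x ∉ A, ∃ j < N, g j = x) {d : ℕ}
    (hd : ∀ x, d ≤ (G.neighborSet x).ncard) {i : ℕ} (hi : i < c) (hi1 : 1 ≤ ℓ i) :
    d + ∑ e ∈ Finset.range c with ℓ e = 0, tr G f ℓ z i e ≤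
      phi G g N (z i (ℓ i)) + nb G ℓ z i i + total G f c ℓ z i := by
  have h1 := hL.degree_le hf.pos hs hgA hd i
  rw [← Finset.add_sum_erase _ _ (Finset.mem_range.2 hi)] at h1
  have h2 := hL.total_eq hf hi
  have h3 : ∑ e ∈ (Finset.range c).erase i, wt G f ℓ z i e =
      ∑ e ∈ (Finset.range c).erase i, nb G ℓ z i e +
        ∑ e ∈ Finset.range c with ℓ e = 0, tr G f ℓ z i e := by
    simp only [wt]
    rw [Finset.sum_add_distrib, Finset.sum_filter]
    congr 1
    refine Finset.sum_erase _ ?_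
    rw [if_neg (by omega)]
  omega

theorem degree_le_of_eq_zero (hf : CycSeq G A f c) (hL : Legs G A f c ℓ z)
    (hs : Saturated G A ℓ z)
    (hgA : ∀ x ∉ A, ∃ j < N, g j = x) {d : ℕ}
    (hd : ∀ x, d ≤ (G.neighborSet x).ncard) {v : ℕ} (hv : ℓ v = 0) :
    d ≤ phi G g N (z v (ℓ v)) + phi G f c (f v) + ∑ i ∈ Finset.range c, tr G f ℓ z i v := by
  classical
  have h1 := hL.degree_le hf.pos hs hgA hd v
  have h2 : ∀ e, nb G ℓ z v e = (if G.Adj (f e) (f v) then 1 else 0) + tr G f ℓ z e v := by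
    intro e
    unfold nb tr
    rw [Finset.range_eq_Ico, ← Finset.insert_Ico_add_one_left_eq_Ico (by omega),
      Finset.filter_insert, hv, hL.zero, hL.zero, zero_add]
    have : Finset.Ico 1 (ℓ e + 1) = Finset.Icc 1 (ℓ e) := rfl
    rw [this]
    split_ifs with h h' h'
    · rw [Finset.card_insert_of_notMem (by simp), add_comm]
    · exact absurd h.symm h'
    · exact absurd h'.symm h
    · simp
  have h3 : phi G f c (f v) = ∑ e ∈ Finset.range c, if G.Adj (f e) (f v) then 1 else 0 := by
    unfold phi
    rw [Finset.card_filter]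
  simp only [h2, Finset.sum_add_distrib, ← h3] at h1
  omega

theorem sum_tr :
    ∑ i ∈ Finset.range c with ¬ ℓ i = 0, ∑ e ∈ Finset.range c with ℓ e = 0, tr G f ℓ z i e =
      ∑ e ∈ Finset.range c with ℓ e = 0, ∑ i ∈ Finset.range c, tr G f ℓ z i e := by
  rw [Finset.sum_comm]
  refine Finset.sum_congr rfl fun e _ => ?_
  rw [Finset.sum_filter]
  refine Finset.sum_congr rfl fun i _ => ?_
  split_ifs with h
  · exact (tr_eq_zero h e).symm
  · rfl

theorem card_mul_degree_le (hf : CycSeq G A f c) (hL : Legs G A f c ℓ z)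
    (hs : Saturated G A ℓ z)
    (hgA : ∀ x ∉ A, ∃ j < N, g j = x) {d : ℕ}
    (hd : ∀ x, d ≤ (G.neighborSet x).ncard) :
    (c + 1) * (c * d) ≤ (c + 1) * ∑ i ∈ Finset.range c, phi G g N (z i (ℓ i)) +
      c * ∑ i ∈ Finset.range c, ℓ i + c * ((c + 1) * (c - 1)) := by
  have hpos : ∀ i ∈ Finset.range c, ¬ ℓ i = 0 →
      (c + 1) * d + (c + 1) * ∑ e ∈ Finset.range c with ℓ e = 0, tr G f ℓ z i e ≤
        (c + 1) * phi G g N (z i (ℓ i)) + (c * ℓ i + (c + 1) * (c - 1)) := by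
    intro i hi hi0
    have h1 := hL.degree_le_of_pos hf hs hgA hd (Finset.mem_range.1 hi) (by omega)
    have h2 := hL.total_le hf (i := i) (by omega)
    have h3 := nb_self_le (G := G) (z := z) (ℓ := ℓ) i
    have h4 := hL.nb_self_le' hf i
    obtain ⟨k, rfl⟩ : ∃ k, c = k + 2 := ⟨c - 2, by omega⟩
    simp only [show k + 2 - 1 = k + 1 by omega]
    nlinarith
  have hzero : ∀ v ∈ Finset.range c, ℓ v = 0 →
      (c + 1) * d ≤ (c + 1) * phi G g N (z v (ℓ v)) + (c * ℓ v + (c + 1) * (c - 1)) +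
        (c + 1) * ∑ i ∈ Finset.range c, tr G f ℓ z i v := by
    intro v hv hv0
    have h1 := hL.degree_le_of_eq_zero hf hs hgA hd hv0
    have h2 := CycSeq.phi_add_one_le (G := G) (f := f) (Finset.mem_range.1 hv)
    have h3 : phi G f c (f v) ≤ c - 1 := by omega
    have h4 := Nat.mul_le_mul_left (c + 1)
      (h1.trans (Nat.add_le_add_right (Nat.add_le_add_left h3 _) _))
    rw [mul_add, mul_add] at h4
    omega
  have H1 := Finset.sum_le_sum (s := (Finset.range c).filter fun i => ¬ ℓ i = 0)
    (fun i hi => hpos i (Finset.mem_filter.1 hi).1 (Finset.mem_filter.1 hi).2)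
  have H2 := Finset.sum_le_sum (s := (Finset.range c).filter fun i => ℓ i = 0)
    (fun i hi => hzero i (Finset.mem_filter.1 hi).1 (Finset.mem_filter.1 hi).2)
  have e1 : ∑ i ∈ Finset.range c, (c + 1) * d = c * ((c + 1) * d) := by simp
  rw [← Finset.sum_filter_add_sum_filter_not _ (fun i => ℓ i = 0)] at e1
  have e2 := Finset.sum_filter_add_sum_filter_not (Finset.range c) (fun i => ℓ i = 0)
    (fun i => (c + 1) * phi G g N (z i (ℓ i)))
  have e3 := Finset.sum_filter_add_sum_filter_not (Finset.range c) (fun i => ℓ i = 0)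
    (fun i => (c * ℓ i + (c + 1) * (c - 1)))
  have e4 : ∑ i ∈ Finset.range c, (c * ℓ i + (c + 1) * (c - 1)) =
      c * ∑ i ∈ Finset.range c, ℓ i + c * ((c + 1) * (c - 1)) := by
    rw [Finset.sum_add_distrib, ← Finset.mul_sum]; simp
  have e5 := congrArg ((c + 1) * ·) (sum_tr (G := G) (f := f) (c := c) (ℓ := ℓ) (z := z))
  simp only [Finset.mul_sum (a := c + 1)] at e5
  simp only [Finset.sum_add_distrib, Finset.mul_sum (a := c + 1)] at H1 H2 e3 e4 ⊢
  have e6 : (c + 1) * (c * d) = c * ((c + 1) * d) := by ring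
  omega

end Legs

theorem Finset.card_add_card_le_of_gap {P Q : Finset ℕ} {c s : ℕ} (hP : ∀ p ∈ P, p < c)
    (hQ : ∀ q ∈ Q, q < c) (h0 : 0 ∈ P) (hQ0 : ∃ q ∈ Q, q ≠ 0) (hs : 2 ≤ s)
    (h1 : ∀ p ∈ P, ∀ q ∈ Q, p < q → p + s ≤ q ∧ q + s ≤ p + c)
    (h2 : ∀ p ∈ P, ∀ q ∈ Q, q < p → q + s ≤ p ∧ p + s ≤ q + c) :
    P.card + Q.card + 2 * s ≤ c + 4 := by
  classical
  obtain ⟨q, hq, hq0⟩ := hQ0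
  have hne : (Q.erase 0).Nonempty := ⟨q, Finset.mem_erase.2 ⟨hq0, hq⟩⟩
  obtain ⟨hm0, hm⟩ := Finset.mem_erase.1 (Finset.min'_mem _ hne)
  obtain ⟨hM0, hM⟩ := Finset.mem_erase.1 (Finset.max'_mem _ hne)
  have hmin : ∀ q ∈ Q, q ≠ 0 → (Q.erase 0).min' hne ≤ q := fun q hq h =>
    Finset.min'_le _ _ (Finset.mem_erase.2 ⟨h, hq⟩)
  have hmax : ∀ q ∈ Q, q ≠ 0 → q ≤ (Q.erase 0).max' hne := fun q hq h =>
    Finset.le_max' _ _ (Finset.mem_erase.2 ⟨h, hq⟩)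
  set m := (Q.erase 0).min' hne
  set M := (Q.erase 0).max' hne
  have hmM := hmin M hM hM0
  have e1 := h1 0 h0 m hm (by omega)
  have e2 := h1 0 h0 M hM (by omega)
  have d1 : Disjoint P (Q.map (addRightEmbedding 1)) := by
    rw [Finset.disjoint_left]
    intro p hp hp'
    obtain ⟨q, hq, rfl⟩ := Finset.mem_map.1 hp'
    have := h2 _ hp q hq (by simp)
    simp at this
    omega
  have d2 : Disjoint (P ∪ Q.map (addRightEmbedding 1)) (Finset.Ico (m + 2 - s) m) := by
    rw [Finset.disjoint_left]
    intro x hx hx'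
    rw [Finset.mem_Ico] at hx'
    rcases Finset.mem_union.1 hx with hx | hx
    · have := h1 x hx m hm hx'.2
      omega
    · obtain ⟨q, hq, rfl⟩ := Finset.mem_map.1 hx
      simp only [addRightEmbedding_apply] at hx'
      have := hmin q hq (by omega)
      omega
  have d3 : Disjoint (P ∪ Q.map (addRightEmbedding 1) ∪ Finset.Ico (m + 2 - s) m)
      (Finset.Ico (M + 2) (M + s)) := by
    rw [Finset.disjoint_left]
    intro x hx hx'
    rw [Finset.mem_Ico] at hx'
    rcases Finset.mem_union.1 hx with hx | hx
    · rcases Finset.mem_union.1 hx with hx | hx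
      · have := h2 x hx M hM (by omega)
        omega
      · obtain ⟨q, hq, rfl⟩ := Finset.mem_map.1 hx
        simp only [addRightEmbedding_apply] at hx'
        have := hmax q hq (by omega)
        omega
    · rw [Finset.mem_Ico] at hx
      omega
  have hsub : P ∪ Q.map (addRightEmbedding 1) ∪ Finset.Ico (m + 2 - s) m ∪
      Finset.Ico (M + 2) (M + s) ⊆ Finset.range c := by
    intro x hx
    rw [Finset.mem_range]
    simp only [Finset.mem_union, Finset.mem_Ico, Finset.mem_map, addRightEmbedding_apply] at hx
    rcases hx with ((hx | ⟨q, hq, rfl⟩) | hx) | hx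
    · exact hP x hx
    · have := hQ q hq
      by_contra h
      have := h1 0 h0 q hq (by omega)
      omega
    · omega
    · omega
  have hcard := Finset.card_le_card hsub
  rw [Finset.card_union_of_disjoint d3, Finset.card_union_of_disjoint d2,
    Finset.card_union_of_disjoint d1, Finset.card_map, Nat.card_Ico, Nat.card_Ico,
    Finset.card_range] at hcard
  omega

namespace Legs

variable {G : SimpleGraph V} {A : Set V} {f g : ℕ → V} {c N : ℕ} {ℓ : ℕ → ℕ} {z : ℕ → ℕ → V}

/-- Vertex `v` has a neighbour on leg `i`. -/
def Sees (G : SimpleGraph V) (ℓ : ℕ → ℕ) (z : ℕ → ℕ → V) (v : V) (i : ℕ) : Prop :=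
  ∃ p ∈ leg ℓ z i, G.Adj v p

theorem long_self (hL : Legs G A f c ℓ z) (i : ℕ) : Long G A ℓ z i i 0 := by
  rintro _ ⟨s, hs, rfl⟩ _ ⟨t, ht, rfl⟩
  have hsub : ∀ a b, b ≤ ℓ i → z i '' Set.Icc a b ⊆ A := by
    rintro a b hb _ ⟨t, ht, rfl⟩
    exact hL.mem i t (ht.2.trans hb)
  rcases le_total s t with h | h
  · exact ⟨_, Nat.zero_le _, (hL.seg i h ht.2).mono (hsub _ _ ht.2)⟩
  · exact ⟨_, Nat.zero_le _, (hL.seg i h hs.2).symm.mono (hsub _ _ hs.2)⟩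

theorem Long.gap (hg : CycSeq G Set.univ g N) (hA : Disjoint A (Set.range g)) {i j d x y : ℕ}
    (h : Long G A ℓ z i j d) (hx : Sees G ℓ z (g x) i) (hy : Sees G ℓ z (g y) j) (hxy : x < y)
    (hyx : y < x + N) : d + 2 ≤ y - x := by
  obtain ⟨p, hp, hxp⟩ := hx
  obtain ⟨q, hq, hyq⟩ := hy
  obtain ⟨n, hn, hpath⟩ := h p hp q hq
  have := hg.gap hxy hyx hpath (Set.subset_univ _) hA hxp hyq
  omega

open scoped Classical in
theorem two_mul_gap (hf : CycSeq G A f c) (hL : Legs G A f c ℓ z) (hg : CycSeq G Set.univ g N)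
    (hA : Disjoint A (Set.range g)) {P Q : ℕ → Prop} {x y : ℕ}
    (hP : Function.Periodic P c) (hQ : Function.Periodic Q c)
    (hPx : ∀ i, P i → Sees G ℓ z (g x) i) (hQy : ∀ i, Q i → Sees G ℓ z (g y) i)
    {a b : ℕ} (ha : P a) (hb : Q b) (hab : ¬ a ≡ b [MOD c]) (hxy : x < y) (hyx : y < x + N) :
    c + 1 ≤ y - x ∨ c + ((Finset.range c).filter P).card + ((Finset.range c).filter Q).card ≤
      2 * (y - x) := by
  by_contra hcon
  push Not at hcon
  have hc := hf.pos
  have key : ∀ p q, p < q → q < p + c → (Sees G ℓ z (g x) (a + p) ∧ Sees G ℓ z (g y) (a + q)) ∨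
      (Sees G ℓ z (g x) (a + q) ∧ Sees G ℓ z (g y) (a + p)) →
      (q - p) + 2 ≤ y - x ∧ (p + c - q) + 2 ≤ y - x := by
    intro p q hpq hqp h
    obtain ⟨l1, l2⟩ := hL.long_of_lt hf (a := a + p) (b := a + q) (by omega) (by omega)
    obtain ⟨l3, l4⟩ := hL.long_of_lt hf (a := a + q) (b := a + p + c) (by omega) (by omega)
    have hm : a + p + c ≡ a + p [MOD c] := by simp [Nat.ModEq]
    have l3 := l3.congr hL rfl hm
    have l4 := l4.congr hL hm rfl
    rcases h with ⟨h1, h2⟩ | ⟨h1, h2⟩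
    · have := l1.gap hg hA h1 h2 hxy hyx
      have := l4.gap hg hA h1 h2 hxy hyx
      omega
    · have := l2.gap hg hA h1 h2 hxy hyx
      have := l3.gap hg hA h1 h2 hxy hyx
      omega
  have hcard : ∀ R : ℕ → Prop, Function.Periodic R c →
      ((Finset.range c).filter fun d => R (a + d)).card = ((Finset.range c).filter R).card := by
    intro R hR
    rw [Finset.card_filter, Finset.card_filter]
    have : Function.Periodic (fun i => if R i then 1 else 0) c := by
      intro i
      simp only [hR i]
    exact this.sum_range_add a
  obtain ⟨d, hdc, hd⟩ := Nat.exists_add_modEq hc a b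
  have hd0 : d ≠ 0 := by
    rintro rfl
    exact hab hd
  have hQd : Q (a + d) := by
    rw [hQ.eq_of_modEq hd]
    exact hb
  have e := key 0 d (by omega) (by omega) (Or.inl ⟨hPx _ ha, hQy _ hQd⟩)
  have hfin := Finset.card_add_card_le_of_gap
    (P := (Finset.range c).filter fun d => P (a + d))
    (Q := (Finset.range c).filter fun d => Q (a + d)) (c := c) (s := c + 2 - (y - x))
    (by simp +contextual) (by simp +contextual) (by simp [hc, ha])
    ⟨d, by simp [hdc, hQd], hd0⟩ (by omega)
    (by
      intro p hp q hq hpq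
      simp only [Finset.mem_filter, Finset.mem_range] at hp hq
      have := key p q hpq (by omega) (Or.inl ⟨hPx _ hp.2, hQy _ hq.2⟩)
      omega)
    (by
      intro p hp q hq hpq
      simp only [Finset.mem_filter, Finset.mem_range] at hp hq
      have := key q p hpq (by omega) (Or.inr ⟨hPx _ hp.2, hQy _ hq.2⟩)
      omega)
  rw [hcard P hP, hcard Q hQ] at hfin
  omega

end Legs

theorem add_one_mul_sum_le {φ : ℕ → ℕ} {c N : ℕ} (hφ : Function.Periodic φ N) (hc : ∀ x, φ x ≤ c)
    (hN : c + 1 ≤ N) (h : ∀ x y, x < y → y < x + N → 0 < φ x → 0 < φ y →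
      (c + 1) * (φ x + φ y) ≤ 2 * c * (y - x)) :
    (c + 1) * ∑ x ∈ Finset.range N, φ x ≤ c * N := by
  by_cases h0 : ∀ x, φ x = 0
  · simp [h0]
  push Not at h0
  obtain ⟨a, ha⟩ := h0
  rw [← hφ.sum_range_add a]
  have key : ∀ n < N, ∃ d ≤ n, 0 < φ (a + d) ∧
      2 * ((c + 1) * ∑ x ∈ Finset.range (n + 1), φ (a + x)) ≤
        (c + 1) * (φ a + φ (a + d)) + 2 * c * d := by
    intro n
    induction n with
    | zero =>
      intro _
      refine ⟨0, le_rfl, Nat.pos_of_ne_zero ha, le_of_eq ?_⟩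
      simp
      ring
    | succ n ih =>
      intro hn
      obtain ⟨d, hd, hd0, hle⟩ := ih (by omega)
      rw [Finset.sum_range_succ]
      by_cases hz : φ (a + (n + 1)) = 0
      · exact ⟨d, by omega, hd0, by rwa [hz, add_zero]⟩
      · refine ⟨n + 1, le_rfl, Nat.pos_of_ne_zero hz, ?_⟩
        have h1 := h (a + d) (a + (n + 1)) (by omega) (by omega) hd0 (Nat.pos_of_ne_zero hz)
        obtain ⟨e, he⟩ : ∃ e, n + 1 = d + e := ⟨n + 1 - d, by omega⟩
        rw [show a + (n + 1) - (a + d) = e by omega] at h1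
        have h2 : 2 * c * (n + 1) = 2 * c * d + 2 * c * e := by rw [he]; ring
        rw [h2]
        nlinarith
  obtain ⟨d, hd, hd0, hle⟩ := key (N - 1) (by omega)
  rw [Nat.sub_add_cancel (by omega)] at hle
  rcases Nat.eq_zero_or_pos d with rfl | hpos
  · have h1 := hc a
    rw [add_zero] at hle
    nlinarith
  · have h1 := h (a + d) (a + N) (by omega) (by omega) hd0 (by rw [hφ a]; omega)
    rw [hφ a] at h1
    obtain ⟨e, he⟩ : ∃ e, N = d + e := ⟨N - d, by omega⟩
    rw [show a + N - (a + d) = e by omega] at h1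
    have h2 : c * N = c * d + c * e := by rw [he]; ring
    rw [h2]
    nlinarith

namespace Legs

variable {G : SimpleGraph V} {A : Set V} {f g : ℕ → V} {c N : ℕ} {ℓ : ℕ → ℕ} {z : ℕ → ℕ → V}

open scoped Classical in
/-- The number of legs whose last vertex is adjacent to `v`. -/
noncomputable def ends (G : SimpleGraph V) (c : ℕ) (ℓ : ℕ → ℕ) (z : ℕ → ℕ → V) (v : V) : ℕ :=
  ((Finset.range c).filter fun i => G.Adj v (z i (ℓ i))).card

theorem sum_phi : ∑ i ∈ Finset.range c, phi G g N (z i (ℓ i)) =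
    ∑ x ∈ Finset.range N, ends G c ℓ z (g x) := by
  classical
  simp only [phi, ends, Finset.card_filter]
  exact Finset.sum_comm

theorem sees_of_adj {v : V} {i : ℕ} (h : G.Adj v (z i (ℓ i))) : Sees G ℓ z v i :=
  ⟨_, ⟨ℓ i, ⟨Nat.zero_le _, le_rfl⟩, rfl⟩, h⟩

theorem ends_le {v : V} : ends G c ℓ z v ≤ c := by
  classical
  exact (Finset.card_filter_le _ _).trans (Finset.card_range c).le

theorem mul_ends_le (hf : CycSeq G A f c) (hL : Legs G A f c ℓ z) (hg : CycSeq G Set.univ g N)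
    (hA : Disjoint A (Set.range g)) {x y : ℕ} (hxy : x < y) (hyx : y < x + N)
    (hx : 0 < ends G c ℓ z (g x)) (hy : 0 < ends G c ℓ z (g y)) :
    (c + 1) * (ends G c ℓ z (g x) + ends G c ℓ z (g y)) ≤ 2 * c * (y - x) := by
  classical
  have hper : ∀ v, Function.Periodic (fun i => G.Adj v (z i (ℓ i))) c := by
    intro v i
    simp only [hL.per_len, hL.per]
  have hc := hf.pos
  by_cases h : ∃ a b, a < c ∧ b < c ∧ G.Adj (g x) (z a (ℓ a)) ∧ G.Adj (g y) (z b (ℓ b)) ∧ a ≠ b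
  · obtain ⟨a, b, hac, hbc, ha, hb, hab⟩ := h
    have h1 := ends_le (G := G) (c := c) (ℓ := ℓ) (z := z) (v := g x)
    have h2 := ends_le (G := G) (c := c) (ℓ := ℓ) (z := z) (v := g y)
    have hgap := hL.two_mul_gap hf hg hA (hper (g x)) (hper (g y)) (fun i => sees_of_adj)
      (fun i => sees_of_adj) ha hb (fun h => hab (h.eq_of_lt_of_lt hac hbc)) hxy hyx
    change c + 1 ≤ y - x ∨ c + ends G c ℓ z (g x) + ends G c ℓ z (g y) ≤ 2 * (y - x) at hgap
    rcases hgap with hgap | hgap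
    · nlinarith
    · have : 2 ≤ c := by omega
      nlinarith
  · push Not at h
    obtain ⟨a, ha⟩ := Finset.card_pos.1 hx
    obtain ⟨b, hb⟩ := Finset.card_pos.1 hy
    rw [Finset.mem_filter, Finset.mem_range] at ha hb
    have h1 : ends G c ℓ z (g x) ≤ 1 := by
      refine Finset.card_le_one.2 fun i hi j hj => ?_
      rw [Finset.mem_filter, Finset.mem_range] at hi hj
      rw [h i b hi.1 hb.1 hi.2 hb.2, h j b hj.1 hb.1 hj.2 hb.2]
    have h2 : ends G c ℓ z (g y) ≤ 1 := by
      refine Finset.card_le_one.2 fun i hi j hj => ?_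
      rw [Finset.mem_filter, Finset.mem_range] at hi hj
      rw [← h a i ha.1 hi.1 ha.2 hi.2, ← h a j ha.1 hj.1 ha.2 hj.2]
    have hab := h a b ha.1 hb.1 ha.2 hb.2
    subst hab
    have h3 := (hL.long_self a).gap hg hA (sees_of_adj ha.2) (sees_of_adj hb.2) hxy hyx
    nlinarith

theorem mul_sum_phi_le (hf : CycSeq G A f c) (hL : Legs G A f c ℓ z)
    (hg : CycSeq G Set.univ g N) (hA : Disjoint A (Set.range g)) (hN : c + 1 ≤ N) :
    (c + 1) * ∑ i ∈ Finset.range c, phi G g N (z i (ℓ i)) ≤ c * N := by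
  rw [sum_phi]
  refine add_one_mul_sum_le (φ := fun x => ends G c ℓ z (g x)) ?_ (fun _ => ends_le) hN
    fun x y hxy hyx hx hy => hL.mul_ends_le hf hg hA hxy hyx hx hy
  intro x
  simp only [hg.per]

end Legs

namespace CycSeq

variable {G : SimpleGraph V} {A : Set V} {f g : ℕ → V} {c N : ℕ}

theorem degree_add_one_le [Finite V] [Nonempty V] {d K : ℕ} (hd : ∀ x, d ≤ (G.neighborSet x).ncard)
    (hd2 : 2 ≤ d) (hK : ∀ (y : V) (w : G.Walk y y), w.IsCycle → w.length ≤ K) : d + 1 ≤ K := by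
  obtain ⟨v⟩ := ‹Nonempty V›
  have h : Legs G Set.univ (fun _ => v) 1 (fun _ => 0) (fun _ _ => v) :=
    ⟨fun _ => rfl, fun _ _ => rfl, fun _ => rfl, fun _ _ _ => trivial, by simp,
      fun i t j s ht hs _ => ⟨Nat.modEq_one, by simp at ht hs; omega⟩⟩
  obtain ⟨ℓ, z, hL, hs, -⟩ := h.exists_saturated one_pos
  have h1 := hL.degree_le one_pos hs (N := 0) (g := fun _ => v) (by simp) hd 0
  have h2 : phi G (fun _ => v) 0 (z 0 (ℓ 0)) = 0 := by simp [phi]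
  rw [h2, Finset.sum_range_one, zero_add] at h1
  have := hL.nb_self_add_one_le (K := K) (fun y w hw _ => hK y w hw) (i := 0) (by omega)
  omega

theorem add_one_mul_degree_le [Finite V] (hf : CycSeq G A f c) (hg : CycSeq G Set.univ g N)
    (hA : A = (Set.range g)ᶜ) {d : ℕ} (hd : ∀ x, d ≤ (G.neighborSet x).ncard) (hN : c + 1 ≤ N) :
    (c + 1) * d + c + 1 ≤ N + A.ncard + c * c := by
  obtain ⟨ℓ, z, hL, hs, -⟩ := hf.legs.exists_saturated hf.pos
  have h1 := hL.card_mul_degree_le hf hs (g := g) (N := N) (fun x hx => by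
    rw [hA, Set.notMem_compl_iff] at hx
    exact CycSeq.mem_range_iff hg |>.1 hx) hd
  have h2 := hL.mul_sum_phi_le hf hg (by rw [hA]; exact disjoint_compl_left) hN
  have h3 := hL.add_sum_le_ncard
  have hpos := hf.pos
  have h4 : c * ((c + 1) * d) ≤ c * (N + ∑ i ∈ Finset.range c, ℓ i + (c + 1) * (c - 1)) := by
    have : (c + 1) * (c * d) = c * ((c + 1) * d) := by ring
    rw [mul_add, mul_add]
    omega
  have h5 := Nat.le_of_mul_le_mul_left h4 hpos
  obtain ⟨k, rfl⟩ : ∃ k, c = k + 1 := ⟨c - 1, by omega⟩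
  rw [Nat.add_sub_cancel] at h5
  nlinarith

end CycSeq

namespace SimpleGraph

variable {G : SimpleGraph V} {X Y : Set V} {k : ℕ}

/-- The relation encoding systems of `k` disjoint paths from `X` to `Y` as perfect matchings. -/
def LinkRel (G : SimpleGraph V) (X Y : Set V) (k : ℕ) : V ⊕ Fin k → V ⊕ Fin k → Prop
  | .inl a, .inl b => a = b ∨ (G.Adj a b ∧ a ∉ Y ∧ b ∉ X)
  | .inl a, .inr _ => a ∈ Y
  | .inr _, .inl b => b ∈ X
  | .inr _, .inr _ => False

theorem exists_linkRel_injective [Finite V]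
    (hsep : ∀ U : Set V, Disjoint U Y → k ≤ {v | v ∉ U ∧ (v ∈ X ∨ ∃ u ∈ U, G.Adj u v)}.ncard) :
    ∃ τ : V ⊕ Fin k → V ⊕ Fin k, τ.Injective ∧ ∀ a, LinkRel G X Y k a (τ a) := by
  classical
  have := Fintype.ofFinite V
  have hall := (Finset.all_card_le_biUnion_card_iff_exists_injective
    (fun a => Finset.univ.filter fun b => LinkRel G X Y k a b)).1 ?_
  · obtain ⟨τ, hτ, h⟩ := hall
    exact ⟨τ, hτ, fun a => by simpa using h a⟩
  intro S
  set T := S.biUnion fun a => Finset.univ.filter fun b => LinkRel G X Y k a b with hT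
  have hmem : ∀ b, b ∈ T ↔ ∃ a ∈ S, LinkRel G X Y k a b := by
    intro b
    simp [hT]
  have hsplit : ∀ S : Finset (V ⊕ Fin k), S.card = S.toLeft.card + S.toRight.card := fun S =>
    Finset.card_toLeft_add_card_toRight.symm
  have hUT : S.toLeft ⊆ T.toLeft := by
    intro a ha
    rw [Finset.mem_toLeft] at ha ⊢
    exact (hmem _).2 ⟨_, ha, Or.inl rfl⟩
  have hU := Finset.card_le_card hUT
  have hJ : S.toRight.card ≤ k := (Finset.card_le_univ _).trans (Fintype.card_fin k).le
  rw [hsplit S, hsplit T]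
  rcases S.toRight.eq_empty_or_nonempty with h0 | ⟨j, hj⟩
  · rw [h0, Finset.card_empty]
    omega
  rw [Finset.mem_toRight] at hj
  by_cases hY : ∃ a ∈ S.toLeft, a ∈ Y
  · obtain ⟨a, ha, haY⟩ := hY
    rw [Finset.mem_toLeft] at ha
    have : T.toRight = Finset.univ := by
      rw [Finset.eq_univ_iff_forall]
      intro i
      rw [Finset.mem_toRight]
      exact (hmem _).2 ⟨_, ha, haY⟩
    rw [this, Finset.card_univ, Fintype.card_fin]
    omega
  · push Not at hY
    have hdis : Disjoint (S.toLeft : Set V) Y :=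
      Set.disjoint_left.2 fun a ha => hY a (Finset.mem_coe.1 ha)
    have h1 := hsep _ hdis
    have h2 : {v | v ∉ (S.toLeft : Set V) ∧ (v ∈ X ∨ ∃ u ∈ (S.toLeft : Set V), G.Adj u v)} ⊆
        ((T.toLeft \ S.toLeft : Finset V) : Set V) := by
      rintro v ⟨hv, hv'⟩
      rw [Finset.mem_coe] at hv
      rw [Finset.mem_coe, Finset.mem_sdiff, Finset.mem_toLeft, hmem]
      refine ⟨?_, hv⟩
      by_cases hvX : v ∈ X
      · exact ⟨_, hj, hvX⟩
      · obtain ⟨u, hu, hadj⟩ := hv'.resolve_left hvX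
        rw [Finset.mem_coe] at hu
        exact ⟨_, Finset.mem_toLeft.1 hu, Or.inr ⟨hadj, hY u hu, hvX⟩⟩
    have h3 := Set.ncard_le_ncard h2 (Finset.finite_toSet _)
    rw [Set.ncard_coe_finset, Finset.card_sdiff_of_subset hUT] at h3
    omega

/-- A form of Menger's theorem, giving disjoint paths with no inner vertex in `X` or `Y`. -/
theorem exists_disjoint_paths [Finite V] (hXY : Disjoint X Y)
    (hsep : ∀ U : Set V, Disjoint U Y → k ≤ {v | v ∉ U ∧ (v ∈ X ∨ ∃ u ∈ U, G.Adj u v)}.ncard) :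
    ∃ (p : Fin k → ℕ → V) (m : Fin k → ℕ),
      (∀ j, 1 ≤ m j ∧ p j 0 ∈ X ∧ p j (m j) ∈ Y ∧ ∀ t < m j, G.Adj (p j t) (p j (t + 1)) ∧
        p j t ∉ Y ∧ p j (t + 1) ∉ X) ∧
      ∀ i j s t, s ≤ m i → t ≤ m j → p i s = p j t → i = j ∧ s = t := by
  classical
  obtain ⟨τ, hτ, hrel⟩ := exists_linkRel_injective hsep
  have hback : ∀ (i j : Fin k) s t, τ^[s + 1] (.inr i) = τ^[t + 1] (.inr j) → s ≤ t →
      τ^[t - s] (.inr j) = .inr i := by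
    intro i j s t h hst
    rw [show t + 1 = (s + 1) + (t - s) by omega, Function.iterate_add_apply τ (s + 1) (t - s)] at h
    exact ((hτ.iterate _) h).symm
  have hne : ∀ (i j : Fin k) t, (∀ s < t, ∃ a, τ^[s + 1] (.inr j) = .inl a) →
      τ^[t] (.inr j) = .inr i → t = 0 ∧ i = j := by
    intro i j t ht h
    cases t with
    | zero => exact ⟨rfl, by simpa using h.symm⟩
    | succ t =>
      obtain ⟨a, ha⟩ := ht t (by omega)
      rw [ha] at h
      simp at h
  have hstep : ∀ j t, (∀ s ≤ t, ∃ a ∉ Y, τ^[s + 1] (.inr j) = .inl a) →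
      ∃ a b, τ^[t + 1] (.inr j) = .inl a ∧ τ^[t + 2] (.inr j) = .inl b ∧ G.Adj a b ∧ a ∉ Y ∧
        b ∉ X := by
    intro j t ht
    obtain ⟨a, haY, ha⟩ := ht t le_rfl
    have h1 := hrel (.inl a)
    have h2 : τ^[t + 2] (.inr j) = τ (.inl a) := by
      rw [Function.iterate_succ_apply', ha]
    rcases hb : τ (.inl a) with b | b
    · rw [hb] at h1 h2
      rcases h1 with rfl | h1
      · have h3 := hback j j t (t + 1) (ha.trans h2.symm) (by omega)
        have := hne j j _ (fun s hs => by
          obtain ⟨a, -, ha⟩ := ht s (by omega)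
          exact ⟨a, ha⟩) h3
        omega
      · exact ⟨a, b, ha, h2, h1⟩
    · rw [hb] at h1
      exact absurd h1 haY
  have hstart : ∀ j, ∃ a ∈ X, τ^[0 + 1] (.inr j) = .inl a := by
    intro j
    have h1 := hrel (.inr j)
    rcases ha : τ (.inr j) with a | a
    · rw [ha] at h1
      exact ⟨a, h1, by simpa using ha⟩
    · rw [ha] at h1
      exact absurd h1 id
  have hend : ∀ j, ∃ t, ∃ a ∈ Y, τ^[t + 1] (.inr j) = .inl a := by
    intro j
    by_contra hcon
    push Not at hcon
    have hall : ∀ t, ∀ s ≤ t, ∃ a ∉ Y, τ^[s + 1] (.inr j) = .inl a := by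
      intro t
      induction t with
      | zero =>
        intro s hs
        obtain rfl : s = 0 := by omega
        obtain ⟨a, -, ha⟩ := hstart j
        exact ⟨a, fun h => hcon 0 a h ha, ha⟩
      | succ t ih =>
        intro s hs
        rcases Nat.lt_or_eq_of_le hs with hs | rfl
        · exact ih s (by omega)
        · obtain ⟨a, b, -, hb, -⟩ := hstep j t ih
          exact ⟨b, fun h => hcon _ b h hb, hb⟩
    obtain ⟨s, t, hst, heq⟩ := Finite.exists_ne_map_eq_of_infinite fun t => τ^[t + 1] (.inr j)
    have hgen : ∀ s t, s < t → τ^[s + 1] (.inr j) = τ^[t + 1] (.inr j) → False := by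
      intro s t hst heq
      have h3 := hback j j s t heq hst.le
      have := hne j j _ (fun r _ => by
        obtain ⟨a, -, ha⟩ := hall r r le_rfl
        exact ⟨a, ha⟩) h3
      omega
    rcases lt_or_gt_of_ne hst with h | h
    · exact hgen s t h heq
    · exact hgen t s h heq.symm
  choose m hm using fun j => (⟨Nat.find (hend j), Nat.find_spec (hend j),
    fun t ht => Nat.find_min (hend j) ht⟩ :
      ∃ m, (∃ a ∈ Y, τ^[m + 1] (.inr j) = .inl a) ∧
        ∀ t < m, ¬ ∃ a ∈ Y, τ^[t + 1] (.inr j) = .inl a)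
  have hall : ∀ j t, t ≤ m j → ∃ a, τ^[t + 1] (.inr j) = .inl a ∧ (t < m j → a ∉ Y) := by
    intro j t
    induction t using Nat.strong_induction_on with
    | _ t ih =>
    intro ht
    have : ∃ a, τ^[t + 1] (.inr j) = .inl a := by
      cases t with
      | zero =>
        obtain ⟨a, -, ha⟩ := hstart j
        exact ⟨a, ha⟩
      | succ t =>
        obtain ⟨a, b, -, hb, -⟩ := hstep j t (fun s hs => by
          obtain ⟨a, ha, ha'⟩ := ih s (by omega) (by omega)
          exact ⟨a, ha' (by omega), ha⟩)
        exact ⟨b, hb⟩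
    obtain ⟨a, ha⟩ := this
    exact ⟨a, ha, fun h1 h2 => (hm j).2 t h1 ⟨a, h2, ha⟩⟩
  have hp : ∀ j, ∃ p : ℕ → V, ∀ t ≤ m j, τ^[t + 1] (.inr j) = .inl (p t) := by
    intro j
    have h : ∀ t, ∃ a, t ≤ m j → τ^[t + 1] (.inr j) = .inl a := by
      intro t
      by_cases ht : t ≤ m j
      · obtain ⟨a, ha, -⟩ := hall j t ht
        exact ⟨a, fun _ => ha⟩
      · obtain ⟨a, -, -⟩ := hall j 0 (Nat.zero_le _)
        exact ⟨a, fun h => absurd h ht⟩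
    choose p hp using h
    exact ⟨p, hp⟩
  choose p hp using hp
  have hpY : ∀ j t, t < m j → p j t ∉ Y := by
    intro j t ht h
    exact (hm j).2 t ht ⟨_, h, hp j t ht.le⟩
  have hpX : ∀ j, p j 0 ∈ X := by
    intro j
    obtain ⟨a, ha, ha'⟩ := hstart j
    rw [hp j 0 (Nat.zero_le _), Sum.inl.injEq] at ha'
    rwa [ha']
  have hpY' : ∀ j, p j (m j) ∈ Y := by
    intro j
    obtain ⟨a, ha, ha'⟩ := (hm j).1
    rw [hp j _ le_rfl, Sum.inl.injEq] at ha'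
    rwa [ha']
  refine ⟨p, m, fun j => ⟨?_, hpX j, hpY' j, fun t ht => ?_⟩, ?_⟩
  · by_contra h
    have h0 : m j = 0 := by omega
    have := hpY' j
    rw [h0] at this
    exact Set.disjoint_left.1 hXY (hpX j) this
  · obtain ⟨a, b, ha, hb, h1, h2, h3⟩ := hstep j t
      (fun s hs => ⟨_, hpY j s (by omega), hp j s (by omega)⟩)
    rw [hp j t ht.le, Sum.inl.injEq] at ha
    rw [hp j (t + 1) ht, Sum.inl.injEq] at hb
    rw [ha, hb]
    exact ⟨h1, h2, h3⟩
  · have hgen : ∀ i j s t, s ≤ m i → t ≤ m j → p i s = p j t → s ≤ t → i = j ∧ s = t := by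
      intro i j s t hs ht h hst
      have h1 := hback i j s t (by rw [hp i s hs, hp j t ht, h]) hst
      have h2 := hne i j _ (fun r hr => ⟨_, hp j r (by omega)⟩) h1
      exact ⟨h2.2, by omega⟩
    intro i j s t hs ht h
    rcases le_total s t with hst | hst
    · exact hgen i j s t hs ht h hst
    · have := hgen j i t s ht hs h.symm hst
      exact ⟨this.1.symm, this.2.symm⟩

end SimpleGraph

theorem IsKConnected.le_ncard [Fintype V] {G : SimpleGraph V} {k : ℕ} (hG : IsKConnected G k)
    {X Y : Set V} (hX : k ≤ X.ncard) (hY : k ≤ Y.ncard) {U : Set V} (hU : Disjoint U Y) :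
    k ≤ {v | v ∉ U ∧ (v ∈ X ∨ ∃ u ∈ U, G.Adj u v)}.ncard := by
  classical
  by_contra hcon
  push Not at hcon
  set T := {v | v ∉ U ∧ (v ∈ X ∨ ∃ u ∈ U, G.Adj u v)} with hT
  have hconn := hG.2 T.toFinset (by rwa [← Set.ncard_eq_toFinset_card'])
  rw [Set.coe_toFinset] at hconn
  obtain ⟨x, hxX, hxT⟩ := Set.exists_mem_notMem_of_ncard_lt_ncard (hcon.trans_le hX)
  obtain ⟨y, hyY, hyT⟩ := Set.exists_mem_notMem_of_ncard_lt_ncard (hcon.trans_le hY)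
  have hxU : x ∈ U := by
    by_contra h
    exact hxT ⟨h, Or.inl hxX⟩
  have hreach := hconn.preconnected ⟨x, hxT⟩ ⟨y, hyT⟩
  obtain ⟨w⟩ := hreach
  have key : ∀ (a b : (Tᶜ : Set V)), (G.induce Tᶜ).Walk a b → (a : V) ∈ U → (b : V) ∈ U := by
    intro a b w
    induction w with
    | nil => exact id
    | cons h _ ih =>
      intro ha
      refine ih ?_
      by_contra hb
      exact (Subtype.property _ : _ ∈ Tᶜ) ⟨hb, Or.inr ⟨_, ha, h⟩⟩
  exact Set.disjoint_left.1 hU (key _ _ w hxU) hyY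

theorem CycSeq.exists_linked_legs [Finite V] {G : SimpleGraph V} {A : Set V} {f g : ℕ → V}
    {c N k : ℕ} (hf : CycSeq G A f c) (hg : CycSeq G Set.univ g N) (hA : A = (Set.range g)ᶜ)
    (hsep : ∀ U : Set V, Disjoint U (Set.range g) →
      k ≤ {v | v ∉ U ∧ (v ∈ Set.range f ∨ ∃ u ∈ U, G.Adj u v)}.ncard) :
    ∃ (ℓ : ℕ → ℕ) (z : ℕ → ℕ → V) (u x : Fin k → ℕ), Legs G A f c ℓ z ∧
      Legs.Saturated G A ℓ z ∧ u.Injective ∧ x.Injective ∧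
      ∀ j, u j < c ∧ x j < N ∧ Legs.Sees G ℓ z (g (x j)) (u j) := by
  classical
  have hfA : Set.range f ⊆ A := by
    rintro _ ⟨i, rfl⟩
    exact hf.mem i
  obtain ⟨p, m, hp, hinj⟩ := exists_disjoint_paths
    (Set.disjoint_left.2 fun x hx h => by
      have := hfA hx
      rw [hA] at this
      exact this h) hsep
  have hstart : ∀ j, ∃ i < c, f i = p j 0 := fun j => hf.mem_range_iff.1 (hp j).2.1
  have hend : ∀ j, ∃ i < N, g i = p j (m j) := fun j => hg.mem_range_iff.1 (hp j).2.2.1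
  choose u hu using hstart
  choose x hx using hend
  have hdata : ∀ v, ∃ (l : ℕ) (w : ℕ → V), w 0 = v ∧
      ((l = 0 ∧ ∀ j, p j 0 ≠ v) ∨ ∃ j, p j 0 = v ∧ l + 1 = m j ∧ w = p j) := by
    intro v
    by_cases h : ∃ j, p j 0 = v
    · obtain ⟨j, hj⟩ := h
      exact ⟨m j - 1, p j, hj, Or.inr ⟨j, hj, by have := (hp j).1; omega, rfl⟩⟩
    · push Not at h
      exact ⟨0, fun _ => v, rfl, Or.inl ⟨rfl, h⟩⟩
  choose L Z hZ0 hZ using hdata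
  have hleg : Legs G A f c (fun i => L (f i)) (fun i => Z (f i)) := by
    refine ⟨fun i => by rw [hf.per], fun i t => by rw [hf.per], fun i => hZ0 _, ?_, ?_, ?_⟩
    · intro i t ht
      rcases hZ (f i) with ⟨h1, -⟩ | ⟨j, h1, h2, h3⟩
      · obtain rfl : t = 0 := by omega
        rw [hZ0]
        exact hf.mem i
      · rw [h3, hA]
        exact ((hp j).2.2.2 t (by omega)).2.1
    · intro i t ht
      rcases hZ (f i) with ⟨h1, -⟩ | ⟨j, h1, h2, h3⟩
      · omega
      · rw [h3]
        exact ((hp j).2.2.2 t (by omega)).1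
    · intro i t i' t' ht ht' heq
      have hfr : ∀ j s, s < m j → p j s ∈ Set.range f → s = 0 := by
        intro j s hs hmem
        cases s with
        | zero => rfl
        | succ s => exact absurd hmem ((hp j).2.2.2 s (by omega)).2.2
      rcases hZ (f i) with ⟨h1, h1'⟩ | ⟨j, h1, h2, h3⟩ <;>
        rcases hZ (f i') with ⟨k1, k1'⟩ | ⟨j', k1, k2, k3⟩
      · obtain rfl : t = 0 := by omega
        obtain rfl : t' = 0 := by omega
        rw [hZ0, hZ0] at heq
        exact ⟨hf.inj _ _ heq, rfl⟩
      · obtain rfl : t = 0 := by omega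
        rw [hZ0, k3] at heq
        obtain rfl := hfr j' t' (by omega) ⟨_, heq⟩
        exact absurd heq.symm (h1' j')
      · obtain rfl : t' = 0 := by omega
        rw [hZ0, h3] at heq
        obtain rfl := hfr j t (by omega) ⟨_, heq.symm⟩
        exact absurd heq (k1' j)
      · rw [h3, k3] at heq
        obtain ⟨rfl, rfl⟩ := hinj _ _ _ _ (by omega) (by omega) heq
        exact ⟨hf.inj _ _ (h1.symm.trans k1), rfl⟩
  obtain ⟨ℓ, z, hL, hs, hle, hz⟩ := hleg.exists_saturated hf.pos
  refine ⟨ℓ, z, u, x, hL, hs, ?_, ?_, fun j => ⟨(hu j).1, (hx j).1, ?_⟩⟩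
  · intro j j' h
    exact (hinj j j' 0 0 (by omega) (by omega) (by rw [← (hu j).2, ← (hu j').2, h])).1
  · intro j j' h
    exact (hinj j j' _ _ le_rfl le_rfl (by rw [← (hx j).2, ← (hx j').2, h])).1
  · have hm := (hp j).1
    have hL1 : L (f (u j)) + 1 = m j ∧ Z (f (u j)) = p j := by
      rcases hZ (f (u j)) with ⟨-, h1⟩ | ⟨j', h1, h2, h3⟩
      · exact absurd (hu j).2.symm (h1 j)
      · rw [(hu j).2] at h1
        obtain ⟨rfl, -⟩ := hinj j' j 0 0 (by omega) (by omega) h1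
        exact ⟨h2, h3⟩
    have h1 := hle (u j)
    have h2 := hz (u j) (L (f (u j))) le_rfl
    rw [hL1.2] at h2
    refine ⟨p j (m j - 1), ⟨L (f (u j)), ⟨Nat.zero_le _, h1⟩, ?_⟩, ?_⟩
    · rw [h2, ← hL1.1, Nat.add_sub_cancel]
    · have := ((hp j).2.2.2 (m j - 1) (by omega)).1
      rw [Nat.sub_add_cancel hm] at this
      rw [(hx j).2]
      exact this.symm

namespace Legs

variable {G : SimpleGraph V} {A : Set V} {f g : ℕ → V} {c N : ℕ} {ℓ : ℕ → ℕ} {z : ℕ → ℕ → V}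

theorem long_phi (hf : CycSeq G A f c) (hL : Legs G A f c ℓ z) (hc : 2 ≤ c) {a b : ℕ}
    (hab : ¬ a ≡ b [MOD c]) :
    Long G A ℓ z a b (phi G f c (f (a + 1))) := by
  classical
  obtain ⟨s, hsc, hs⟩ := Nat.exists_add_modEq hf.pos a b
  have hs0 : s ≠ 0 := by
    rintro rfl
    exact hab hs
  have hac : a + c ≡ a [MOD c] := by simp [Nat.ModEq]
  obtain ⟨t, hst, htc, ht, hfirst⟩ := Finset.exists_first
    (p := fun t => G.Adj (f (a + t)) (f (a + 1))) (a := s + 1) (b := c + 1) (x := c)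
    (by omega) (by omega) (by rw [hf.per]; exact hf.adj hc a)
  have hcard : phi G f c (f (a + 1)) ≤ c - t + s := by
    have hper : Function.Periodic (fun x => if G.Adj (f x) (f (a + 1)) then 1 else 0) c := by
      intro x
      simp only [hf.per]
    unfold phi
    rw [Finset.card_filter, ← hper.sum_range_add (a + 2), ← Finset.card_filter]
    have hsub : ((Finset.range c).filter fun d => G.Adj (f (a + 2 + d)) (f (a + 1))) ⊆
        Finset.range (s - 1) ∪ Finset.Ico (t - 2) (c - 1) := by
      intro d hd
      rw [Finset.mem_filter, Finset.mem_range] at hd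
      rw [Finset.mem_union, Finset.mem_range, Finset.mem_Ico]
      by_contra hcon
      rcases Nat.lt_or_ge d (t - 2) with h | h
      · refine hfirst (d + 2) (by omega) (by omega) ?_
        rw [show a + (d + 2) = a + 2 + d by ring]
        exact hd.2
      · have h1 : d = c - 1 := by omega
        subst h1
        rw [show a + 2 + (c - 1) = a + 1 + c by omega, hf.per] at hd
        exact G.loopless.irrefl _ hd.2
    refine (Finset.card_le_card hsub).trans ((Finset.card_union_le _ _).trans ?_)
    rw [Finset.card_range, Nat.card_Ico]
    omega
  intro p hp q hq
  obtain ⟨m, hm⟩ := hL.up hp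
  obtain ⟨n, hn⟩ := hL.up hq
  rw [← hf.per a] at hm
  rw [← hf.eq_of_modEq hs] at hn
  have hP : ∀ u ∈ leg ℓ z a, u ∈ Set.range f → u = f (a + c) := by
    rw [hf.per]
    exact hL.leg_inter
  have hQ : ∀ u ∈ leg ℓ z b, u ∈ Set.range f → u = f (a + s) := by
    rw [hf.eq_of_modEq hs]
    exact hL.leg_inter
  have h1 := hf.arc_append (x := a + t) (by omega) (by omega) hm hP
  have h2 := hf.arc_append (x := a + 1) (by omega) (by omega) hn hQ
  have h3 := h1.symm.append h2 ?_ ht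
  · refine ⟨_, by omega, h3.mono ?_⟩
    simp only [Set.union_subset_iff]
    exact ⟨⟨hf.image_subset _, hL.leg_subset _⟩, hf.image_subset _, hL.leg_subset _⟩
  · simp only [Set.disjoint_union_left, Set.disjoint_union_right]
    refine ⟨⟨(hf.disjoint_arc (by omega) (by omega)).symm,
      (CycSeq.disjoint_arc_of_inter hP (hf.notMem_arc (by omega) (by omega))).symm⟩,
      CycSeq.disjoint_arc_of_inter hQ (hf.notMem_arc' (by omega) (by omega)),
      hL.disjoint_leg hab⟩

theorem long_total_of_modEq (hf : CycSeq G A f c) (hL : Legs G A f c ℓ z) {i a b : ℕ}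
    (hi : 1 ≤ ℓ i) (hab : ¬ a ≡ b [MOD c])
    (hv : a + 1 ≡ i [MOD c] ∨ ℓ (a + 1) = 0 ∧ 0 < tr G f ℓ z i (a + 1)) :
    Long G A ℓ z a b (total G f c ℓ z i) := by
  have hc := hf.pos
  obtain ⟨s, hsc, hs⟩ := Nat.exists_add_modEq hc i b
  obtain ⟨t, htc, ht⟩ := Nat.exists_add_modEq hc i (a + 1)
  have ha : i + t + c - 1 ≡ a [MOD c] := by
    refine Nat.ModEq.add_right_cancel' 1 ?_
    rw [show i + t + c - 1 + 1 = i + t + c by omega]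
    exact (by simp [Nat.ModEq] : i + t + c ≡ i + t [MOD c]).trans ht
  refine (hL.long_total hf hi htc hsc (a := i + t + c - 1) (by omega)
    (fun h => hab (ha.symm.trans (h.trans hs))) ?_).congr hL ha hs
  rcases hv with hv | ⟨h0, htr⟩
  · left
    have h := ht.trans hv
    by_contra h0
    exact Nat.not_modEq_of_lt' (by omega : i < i + t) (by omega) h
  · right
    have h1 := hL.len_eq ht
    have h2 : wt G f ℓ z i (i + t) = wt G f ℓ z i (a + 1) :=
      Function.Periodic.eq_of_modEq (hL.wt_periodic hf i) ht
    refine ⟨Nat.pos_of_ne_zero ?_, h1.trans h0, ?_⟩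
    · rintro rfl
      rw [add_zero] at h1
      omega
    · rw [h2, wt, if_pos h0]
      omega

theorem sum_deficit_le (hf : CycSeq G A f c) (hL : Legs G A f c ℓ z) (hs : Saturated G A ℓ z)
    (hgA : ∀ x ∉ A, ∃ j < N, g j = x) {d k : ℕ} (hd : ∀ x, d ≤ (G.neighborSet x).ncard)
    {E : ℕ → ℕ} (hE : ∀ v < c, 0 < E v → ∃ D, E v + D + k ≤ d ∧
      (ℓ v = 0 → phi G f c (f v) ≤ D) ∧
      ∀ i < c, 1 ≤ ℓ i → (v = i ∨ ℓ v = 0 ∧ 0 < tr G f ℓ z i v) → total G f c ℓ z i ≤ D) :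
    ∑ v ∈ Finset.range c, E v ≤
      ∑ i ∈ Finset.range c, (phi G g N (z i (ℓ i)) - k) + ∑ i ∈ Finset.range c, ℓ i := by
  classical
  set w : ℕ → ℕ → ℕ := fun i e => if 0 < E e then tr G f ℓ z i e else 0 with hw
  have hwle : ∀ i e, w i e ≤ tr G f ℓ z i e := by
    intro i e
    simp only [hw]
    split_ifs <;> omega
  have hzero : ∀ v ∈ Finset.range c, ℓ v = 0 →
      E v ≤ (phi G g N (z v (ℓ v)) - k) + ℓ v + ∑ i ∈ Finset.range c, w i v := by
    intro v hv h0
    rcases Nat.eq_zero_or_pos (E v) with h | h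
    · omega
    · obtain ⟨D, h1, h2, -⟩ := hE v (Finset.mem_range.1 hv) h
      have h3 := hL.degree_le_of_eq_zero hf hs hgA hd h0
      have h4 := h2 h0
      simp only [hw, if_pos h]
      omega
  have hpos : ∀ i ∈ Finset.range c, ¬ ℓ i = 0 →
      E i + ∑ e ∈ Finset.range c with ℓ e = 0, w i e ≤ (phi G g N (z i (ℓ i)) - k) + ℓ i := by
    intro i hi h0
    rw [Finset.mem_range] at hi
    have h1 := hL.degree_le_of_pos hf hs hgA hd hi (Nat.pos_of_ne_zero h0)
    have h2 := nb_self_le (G := G) (ℓ := ℓ) (z := z) i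
    have h3 : ∑ e ∈ Finset.range c with ℓ e = 0, w i e ≤
        ∑ e ∈ Finset.range c with ℓ e = 0, tr G f ℓ z i e :=
      Finset.sum_le_sum fun e _ => hwle i e
    rcases Nat.eq_zero_or_pos (E i) with h | h
    · by_cases h4 : ∑ e ∈ Finset.range c with ℓ e = 0, w i e = 0
      · omega
      · obtain ⟨e, he, hwe⟩ := Finset.exists_ne_zero_of_sum_ne_zero h4
        rw [Finset.mem_filter, Finset.mem_range] at he
        simp only [hw, ne_eq, ite_eq_right_iff, not_forall] at hwe
        obtain ⟨h5, h6⟩ := hwe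
        obtain ⟨D, h7, -, h8⟩ := hE e he.1 h5
        have := h8 i hi (Nat.pos_of_ne_zero h0) (Or.inr ⟨he.2, Nat.pos_of_ne_zero h6⟩)
        omega
    · obtain ⟨D, h7, -, h8⟩ := hE i hi h
      have := h8 i hi (Nat.pos_of_ne_zero h0) (Or.inl rfl)
      omega
  have hcomm : ∑ i ∈ Finset.range c with ¬ ℓ i = 0, ∑ e ∈ Finset.range c with ℓ e = 0, w i e =
      ∑ e ∈ Finset.range c with ℓ e = 0, ∑ i ∈ Finset.range c, w i e := by
    rw [Finset.sum_comm]
    refine Finset.sum_congr rfl fun e _ => ?_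
    rw [Finset.sum_filter]
    refine Finset.sum_congr rfl fun i _ => ?_
    split_ifs with h
    · have := hwle i e
      rw [tr_eq_zero h e] at this
      omega
    · rfl
  have h1 : ∑ v ∈ Finset.range c with ℓ v = 0, E v ≤
      ∑ v ∈ Finset.range c with ℓ v = 0,
        ((phi G g N (z v (ℓ v)) - k) + ℓ v + ∑ i ∈ Finset.range c, w i v) :=
    Finset.sum_le_sum fun v hv => hzero v (Finset.mem_filter.1 hv).1 (Finset.mem_filter.1 hv).2
  have h2 : ∑ i ∈ Finset.range c with ¬ ℓ i = 0,
      (E i + ∑ e ∈ Finset.range c with ℓ e = 0, w i e) ≤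
      ∑ i ∈ Finset.range c with ¬ ℓ i = 0, ((phi G g N (z i (ℓ i)) - k) + ℓ i) :=
    Finset.sum_le_sum fun v hv => hpos v (Finset.mem_filter.1 hv).1 (Finset.mem_filter.1 hv).2
  rw [Finset.sum_add_distrib] at h1 h2
  rw [hcomm] at h2
  have h3 := Finset.sum_filter_add_sum_filter_not (Finset.range c) (fun v => ℓ v = 0) E
  have h4 := Finset.sum_filter_add_sum_filter_not (Finset.range c) (fun v => ℓ v = 0)
    (fun i => (phi G g N (z i (ℓ i)) - k) + ℓ i)
  rw [Finset.sum_add_distrib (s := Finset.range c)] at h4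
  omega

end Legs

theorem add_sum_card_le_of_gap {B : ℕ → Finset ℕ} {c D n a b : ℕ} (hD : D + 2 ≤ c) (hab : a ≠ b)
    (hcard : ∀ y, (B y).card ≤ c) (h0 : B 0 = {a}) (hn : B n = {b})
    (h1 : ∀ t y, t < y → y ≤ n → ∀ p ∈ B t, ∀ q ∈ B y, p ≠ q →
      c + 1 ≤ y - t ∨ c + (B t).card + (B y).card ≤ 2 * (y - t))
    (h2 : ∀ t y, t < y → y ≤ n → (B t).Nonempty → (B y).Nonempty → 2 ≤ y - t)
    (h3 : ∀ t y, t < y → y ≤ n → a ∈ B t → b ∈ B y → D + 2 ≤ y - t) :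
    D + 1 + ∑ y ∈ Finset.range n, (B (y + 1)).card ≤ n := by
  classical
  set S : ℕ → ℕ := fun t => ∑ y ∈ Finset.range t, (B (y + 1)).card with hS
  have key : ∀ y ≤ n, ∃ t ≤ y, (B t).Nonempty ∧ S y = S t ∧ (y = n → t = n) ∧
      (B t = {a} ∧ S t ≤ t ∨ 1 + 2 * S t + c ≤ 2 * t + (B t).card ∧
        (B t = {b} → D + 1 + S t ≤ t ∨ S t + c ≤ t)) := by
    intro y
    induction y with
    | zero =>
      intro _
      refine ⟨0, le_rfl, by simp [h0], rfl, fun h => h, Or.inl ⟨h0, by simp [hS]⟩⟩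
    | succ y ih =>
      intro hy
      obtain ⟨t, hty, hne, hSt, -, ht⟩ := ih (by omega)
      have hsucc : S (y + 1) = S t + (B (y + 1)).card := by
        rw [← hSt]
        exact Finset.sum_range_succ _ _
      rcases Finset.eq_empty_or_nonempty (B (y + 1)) with he | hne'
      · refine ⟨t, by omega, hne, by rw [hsucc, he]; simp, ?_, ht⟩
        rintro rfl
        rw [hn] at he
        exact absurd he (Finset.singleton_ne_empty b)
      refine ⟨y + 1, le_rfl, hne', rfl, fun h => h, ?_⟩
      have g2 := h2 t (y + 1) (by omega) hy hne hne'
      have hc := hcard t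
      have hc' := hcard (y + 1)
      rw [hsucc]
      by_cases hpq : ∃ p ∈ B t, ∃ q ∈ B (y + 1), p ≠ q
      · obtain ⟨p, hp, q, hq, hpq⟩ := hpq
        have g1 := h1 t (y + 1) (by omega) hy p hp q hq hpq
        right
        rcases ht with ⟨hta, ht⟩ | ⟨ht, -⟩
        · have hca : (B t).card = 1 := by rw [hta, Finset.card_singleton]
          refine ⟨by omega, fun hb => Or.inl ?_⟩
          have g3 := h3 t (y + 1) (by omega) hy (by simp [hta]) (by simp [hb])
          have hcb : (B (y + 1)).card = 1 := by rw [hb, Finset.card_singleton]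
          omega
        · refine ⟨by omega, fun hb => Or.inr ?_⟩
          have hcb : (B (y + 1)).card = 1 := by rw [hb, Finset.card_singleton]
          omega
      · push Not at hpq
        obtain ⟨p, hp⟩ := hne
        obtain ⟨q, hq⟩ := hne'
        have hB : B t = {q} :=
          Finset.eq_singleton_iff_unique_mem.2 ⟨hpq p hp q hq ▸ hp, fun x hx => hpq x hx q hq⟩
        have hB' : B (y + 1) = {q} :=
          Finset.eq_singleton_iff_unique_mem.2
            ⟨hq, fun x hx => (hpq p hp x hx).symm.trans (hpq p hp q hq)⟩
        rw [hB, Finset.card_singleton] at ht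
        rw [hB', Finset.card_singleton]
        rcases ht with ⟨hta, ht⟩ | ⟨ht, ht'⟩
        · exact Or.inl ⟨hta, by omega⟩
        · refine Or.inr ⟨by omega, fun hb => ?_⟩
          rcases ht' hb with h | h
          · left; omega
          · right; omega
  obtain ⟨t, -, -, hSt, htn, ht⟩ := key n le_rfl
  obtain rfl := htn rfl
  change D + 1 + S t ≤ t
  rcases ht with ⟨ha, -⟩ | ⟨-, ht⟩
  · rw [hn, Finset.singleton_inj] at ha
    exact absurd ha.symm hab
  · rcases ht hn with h | h <;> omega

theorem sum_add_sum_le_of_segments {N : ℕ} {M : Finset ℕ} {D e : ℕ → ℕ} (hM : M ⊆ Finset.range N)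
    (hne : M.Nonempty) (he : Function.Periodic e N)
    (h : ∀ x y, x < y → y ≤ x + N → x % N ∈ M → y % N ∈ M →
      (∀ t, x < t → t < y → t % N ∉ M) →
      D (x % N) + 1 + ∑ t ∈ Finset.range (y - x), e (x + t + 1) ≤ y - x) :
    ∑ x ∈ M, (D x + 1) + ∑ x ∈ Finset.range N, e x ≤ N := by
  classical
  obtain ⟨a, ha⟩ := hne
  have haN := Finset.mem_range.1 (hM ha)
  have ha' : a % N ∈ M := by rwa [Nat.mod_eq_of_lt haN]
  set w : ℕ → ℕ := fun x => if x % N ∈ M then D (x % N) + 1 else 0 with hw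
  have key : ∀ n, n ≤ N → (a + n) % N ∈ M →
      ∑ t ∈ Finset.range n, w (a + t) + ∑ t ∈ Finset.range n, e (a + t + 1) ≤ n := by
    intro n
    induction n using Nat.strong_induction_on with
    | _ n ih =>
      intro hn hmem
      rcases Nat.eq_zero_or_pos n with rfl | hpos
      · simp
      obtain ⟨m, -, hmn, hm, hlast⟩ := Finset.exists_last (p := fun m => (a + m) % N ∈ M)
        (a := 0) (b := n) (x := 0) le_rfl hpos ha'
      have h1 := ih m hmn (by omega) hm
      have h2 := h (a + m) (a + n) (by omega) (by omega) hm hmem (by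
        intro t ht ht'
        have := hlast (t - a) (by omega) (by omega)
        rwa [show a + (t - a) = t by omega] at this)
      rw [show a + n - (a + m) = n - m by omega] at h2
      obtain ⟨r, rfl⟩ : ∃ r, n = m + (r + 1) := ⟨n - m - 1, by omega⟩
      rw [Nat.add_sub_cancel_left] at h2
      rw [Finset.sum_range_add _ m (r + 1), Finset.sum_range_add _ m (r + 1),
        Finset.sum_range_succ' (fun t => w (a + (m + t)))]
      have h3 : ∑ t ∈ Finset.range r, w (a + (m + (t + 1))) = 0 := by
        refine Finset.sum_eq_zero fun t ht => ?_
        have := hlast (m + (t + 1)) (by omega) (by have := Finset.mem_range.1 ht; omega)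
        simp only [hw, if_neg this]
      have h4 : w (a + (m + 0)) = D ((a + m) % N) + 1 := by
        simp only [hw, add_zero, if_pos hm]
      have h5 : ∑ t ∈ Finset.range (r + 1), e (a + (m + t) + 1) =
          ∑ t ∈ Finset.range (r + 1), e (a + m + t + 1) :=
        Finset.sum_congr rfl fun t _ => by rw [add_assoc a m t]
      rw [h3, h4, h5]
      omega
  have h1 := key N le_rfl (by rwa [Nat.add_mod_right])
  have hwper : Function.Periodic w N := by
    intro x
    simp only [hw, Nat.add_mod_right]
  rw [hwper.sum_range_add] at h1
  have h2 : ∑ t ∈ Finset.range N, e (a + t + 1) = ∑ x ∈ Finset.range N, e x := by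
    rw [← he.sum_range_add (a + 1)]
    exact Finset.sum_congr rfl fun t _ => by rw [add_right_comm]
  have h3 : ∑ x ∈ Finset.range N, w x = ∑ x ∈ M, (D x + 1) := by
    rw [← Finset.sum_subset hM]
    · refine Finset.sum_congr rfl fun x hx => ?_
      simp only [hw, Nat.mod_eq_of_lt (Finset.mem_range.1 (hM hx)), if_pos hx]
    · intro x hx hxM
      simp only [hw, Nat.mod_eq_of_lt (Finset.mem_range.1 hx), if_neg hxM]
  omega

namespace Legs

variable {G : SimpleGraph V} {A : Set V} {f g : ℕ → V} {c N : ℕ} {ℓ : ℕ → ℕ} {z : ℕ → ℕ → V}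

theorem Long.mono {a b x y : ℕ} (h : Long G A ℓ z a b x) (hyx : y ≤ x) : Long G A ℓ z a b y := by
  intro p hp q hq
  obtain ⟨n, hn, hpath⟩ := h p hp q hq
  exact ⟨n, hyx.trans hn, hpath⟩

theorem segment_le (hf : CycSeq G A f c) (hL : Legs G A f c ℓ z) (hg : CycSeq G Set.univ g N)
    (hA : Disjoint A (Set.range g)) (hc : 2 ≤ c) {B : ℕ → Finset ℕ}
    (hBc : ∀ y, B y ⊆ Finset.range c) (hB : ∀ y, ∀ i ∈ B y, Sees G ℓ z (g y) i)
    {a b x y D : ℕ} (hab : a ≠ b) (hxy : x < y) (hyx : y < x + N) (hx : B x = {a})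
    (hy : B y = {b}) (hD : D + 2 ≤ c) (hlong : Long G A ℓ z a b D) :
    D + 1 + ∑ t ∈ Finset.range (y - x), (B (x + t + 1)).card ≤ y - x := by
  classical
  have hlt : ∀ {y i}, i ∈ B y → i < c := fun h => Finset.mem_range.1 (hBc _ h)
  have hcard : ∀ y (inst : DecidablePred fun i => i % c ∈ B y),
      (@Finset.filter _ (fun i => i % c ∈ B y) inst (Finset.range c)).card = (B y).card := by
    intro y inst
    congr 1
    ext i
    rw [Finset.mem_filter, Finset.mem_range]
    constructor
    · rintro ⟨h1, h2⟩
      rwa [Nat.mod_eq_of_lt h1] at h2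
    · intro h
      rw [Nat.mod_eq_of_lt (hlt h)]
      exact ⟨hlt h, h⟩
  have hper : ∀ y, Function.Periodic (fun i => i % c ∈ B y) c := by
    intro y i
    simp only [Nat.add_mod_right]
  have hsees : ∀ y i, i % c ∈ B y → Sees G ℓ z (g y) i := by
    intro y i h
    obtain ⟨p, hp, hp'⟩ := hB y _ h
    rw [hL.leg_eq (Nat.mod_modEq i c)] at hp
    exact ⟨p, hp, hp'⟩
  have h1 : ∀ t s, t < s → s ≤ y - x → ∀ p ∈ B (x + t), ∀ q ∈ B (x + s), p ≠ q →
      c + 1 ≤ s - t ∨ c + (B (x + t)).card + (B (x + s)).card ≤ 2 * (s - t) := by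
    intro t s hts hs p hp q hq hpq
    have := hL.two_mul_gap hf hg hA (hper (x + t)) (hper (x + s)) (hsees _) (hsees _)
      (a := p) (b := q) (by rwa [Nat.mod_eq_of_lt (hlt hp)]) (by rwa [Nat.mod_eq_of_lt (hlt hq)])
      (fun h => hpq (h.eq_of_lt_of_lt (hlt hp) (hlt hq))) (by omega : x + t < x + s) (by omega)
    rw [hcard, hcard] at this
    omega
  refine add_sum_card_le_of_gap (B := fun t => B (x + t)) hD hab
    (fun t => (Finset.card_le_card (hBc _)).trans (Finset.card_range c).le) hx
    (by rwa [Nat.add_sub_cancel' hxy.le]) h1 ?_ ?_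
  · rintro t s hts hs ⟨p, hp⟩ ⟨q, hq⟩
    by_cases hpq : p = q
    · subst hpq
      have := (hL.long_self p).gap hg hA (hB _ _ hp) (hB _ _ hq) (by omega) (by omega)
      omega
    · have := h1 t s hts hs p hp q hq hpq
      have := Finset.card_pos.2 ⟨p, hp⟩
      have := Finset.card_pos.2 ⟨q, hq⟩
      omega
  · intro t s hts hs ha hb
    have := hlong.gap hg hA (hB _ _ ha) (hB _ _ hb) (by omega) (by omega)
    omega

theorem sum_phi_sub_le {M : Finset ℕ} {k : ℕ} (hk : M.card = k) :
    ∑ i ∈ Finset.range c, (phi G g N (z i (ℓ i)) - k) ≤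
      ∑ y ∈ Finset.range N \ M, ends G c ℓ z (g y) := by
  classical
  simp only [ends, Finset.card_filter]
  rw [Finset.sum_comm]
  refine Finset.sum_le_sum fun i _ => ?_
  rw [← Finset.card_filter, phi, tsub_le_iff_right, ← hk]
  refine (Finset.card_le_card ?_).trans (Finset.card_union_le _ _)
  intro y hy
  rw [Finset.mem_filter] at hy
  rw [Finset.mem_union, Finset.mem_filter, Finset.mem_sdiff]
  tauto

end Legs

namespace CycSeq

variable {G : SimpleGraph V} {A : Set V} {f g : ℕ → V} {c N : ℕ}

theorem mul_degree_le_of_linked [Finite V] (hf : CycSeq G A f c) (hg : CycSeq G Set.univ g N)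
    (hA : A = (Set.range g)ᶜ) {d k : ℕ} (hd : ∀ x, d ≤ (G.neighborSet x).ncard) (hk2 : 2 ≤ k)
    (hkd : k ≤ d) (hkc : d + 2 ≤ c + k)
    (hsep : ∀ U : Set V, Disjoint U (Set.range g) →
      k ≤ {v | v ∉ U ∧ (v ∈ Set.range f ∨ ∃ u ∈ U, G.Adj u v)}.ncard) :
    k * (d - k + 2) + c ≤ N + A.ncard := by
  classical
  obtain ⟨ℓ, z, u, x, hL, hs, hu, hx, hux⟩ := hf.exists_linked_legs hg hA hsep
  have hdisj : Disjoint A (Set.range g) := by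
    rw [hA]
    exact disjoint_compl_left
  have hgA : ∀ v ∉ A, ∃ j < N, g j = v := by
    intro v hv
    rw [hA, Set.notMem_compl_iff] at hv
    exact hg.mem_range_iff.1 hv
  have hNpos := hg.pos
  have hcpos := hf.pos
  have hc2 : 2 ≤ c := by omega
  set M : Finset ℕ := Finset.univ.image x with hM
  have hMk : M.card = k := by
    rw [hM, Finset.card_image_of_injective _ hx, Finset.card_univ, Fintype.card_fin]
  have hMN : M ⊆ Finset.range N := by
    intro y hy
    obtain ⟨j, -, rfl⟩ := Finset.mem_image.1 hy
    exact Finset.mem_range.2 (hux j).2.1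
  obtain ⟨U, hU⟩ : ∃ U : ℕ → ℕ, ∀ j, U (x j) = u j := ⟨Function.extend x u 0, hx.extend_apply u 0⟩
  have hUM : ∀ y ∈ M, U y < c ∧ Legs.Sees G ℓ z (g y) (U y) := by
    intro y hy
    obtain ⟨j, -, rfl⟩ := Finset.mem_image.1 hy
    rw [hU]
    exact ⟨(hux j).1, (hux j).2.2⟩
  have hUinj : ∀ y ∈ M, ∀ y' ∈ M, U y = U y' → y = y' := by
    intro y hy y' hy' h
    obtain ⟨j, -, rfl⟩ := Finset.mem_image.1 hy
    obtain ⟨j', -, rfl⟩ := Finset.mem_image.1 hy'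
    rw [hU, hU] at h
    rw [hu h]
  have hUmod : ∀ y ∈ M, ∀ y' ∈ M, U y ≡ U y' [MOD c] → y = y' := fun y hy y' hy' h =>
    hUinj y hy y' hy' (h.eq_of_lt_of_lt (hUM y hy).1 (hUM y' hy').1)
  have hnext : ∀ y, y ∈ M → ∃ y' ∈ M, y' ≠ y ∧ ∀ r s, r % N = y → r < s → s ≤ r + N → s % N ∈ M →
      (∀ t, r < t → t < s → t % N ∉ M) → s < r + N ∧ s % N = y' := by
    intro y hy
    have hyN : y % N = y := Nat.mod_eq_of_lt (Finset.mem_range.1 (hMN hy))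
    have hmod : ∀ r t, r % N = y → (r + t) % N = (y + t) % N := by
      intro r t h
      rw [← Nat.mod_add_mod, h]
    obtain ⟨y₁, hy₁, hne⟩ := Finset.exists_mem_ne (by omega : 1 < M.card) y
    obtain ⟨s₁, hs₁, hs₁'⟩ := Nat.exists_add_modEq hNpos y y₁
    have hy₁N : y₁ % N = y₁ := Nat.mod_eq_of_lt (Finset.mem_range.1 (hMN hy₁))
    rw [Nat.ModEq, hy₁N] at hs₁'
    have hs₁0 : s₁ ≠ 0 := by
      rintro rfl
      rw [add_zero, hyN] at hs₁'
      exact hne hs₁'.symm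
    obtain ⟨s, h1, h2, h3, h4⟩ := Finset.exists_first (p := fun s => (y + s) % N ∈ M)
      (a := 1) (b := N) (x := s₁) (by omega) hs₁ (by rw [hs₁']; exact hy₁)
    refine ⟨_, h3, ?_, ?_⟩
    · intro h
      exact Nat.not_modEq_of_lt' (by omega : y < y + s) (by omega) (h.trans hyN.symm)
    · intro r s' hr hrs hsr hs' hfirst
      have e : s' = r + s := by
        obtain ⟨q, rfl⟩ : ∃ q, s' = r + q := ⟨s' - r, by omega⟩
        rcases lt_trichotomy q s with h | h | h
        · exact absurd (hmod r q hr ▸ hs') (h4 q (by omega) h)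
        · rw [h]
        · exact absurd ((hmod r s hr).symm ▸ h3) (hfirst (r + s) (by omega) (by omega))
      subst e
      exact ⟨by omega, hmod r s hr⟩
  choose! nx hnxM hnxne hnx using hnext
  have hnot : ∀ y ∈ M, ¬ U y ≡ U (nx y) [MOD c] := fun y hy h =>
    hnxne y hy (hUmod _ hy _ (hnxM y hy) h).symm
  set D : ℕ → ℕ := fun y => Nat.findGreatest (Legs.Long G A ℓ z (U y) (U (nx y))) (d - k) with hDdef
  have hDle : ∀ y, D y ≤ d - k := fun y => Nat.findGreatest_le _
  have hDlong : ∀ y ∈ M, Legs.Long G A ℓ z (U y) (U (nx y)) (D y) := fun y hy =>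
    Nat.findGreatest_spec (P := Legs.Long G A ℓ z (U y) (U (nx y))) (Nat.zero_le _)
      ((hL.long_phi hf hc2 (hnot y hy)).mono (Nat.zero_le _))
  have hDmax : ∀ y, D y < d - k → ∀ X, Legs.Long G A ℓ z (U y) (U (nx y)) X → X ≤ D y := by
    intro y hy X hX
    by_contra hcon
    have : min X (d - k) ≤ D y :=
      Nat.le_findGreatest (min_le_right _ _) (hX.mono (min_le_left _ _))
    omega
  set B : ℕ → Finset ℕ := fun y => if y % N ∈ M then {U (y % N)} else
    (Finset.range c).filter fun i => G.Adj (g y) (z i (ℓ i)) with hB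
  have hgmod : ∀ y, g (y % N) = g y := fun y => hg.eq_of_modEq (Nat.mod_modEq _ _)
  have hBM : ∀ y, y % N ∈ M → B y = {U (y % N)} := fun y hy => by simp only [hB, if_pos hy]
  have hBper : Function.Periodic (fun y => (B y).card) N := by
    intro y
    simp only [hB, Nat.add_mod_right, hg.per]
  have hBc : ∀ y, B y ⊆ Finset.range c := by
    intro y
    by_cases hy : y % N ∈ M
    · rw [hBM y hy, Finset.singleton_subset_iff, Finset.mem_range]
      exact (hUM _ hy).1
    · simp only [hB, if_neg hy]
      exact Finset.filter_subset _ _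
  have hBsees : ∀ y, ∀ i ∈ B y, Legs.Sees G ℓ z (g y) i := by
    intro y i hi
    by_cases hy : y % N ∈ M
    · rw [hBM y hy, Finset.mem_singleton] at hi
      rw [hi, ← hgmod]
      exact (hUM _ hy).2
    · simp only [hB, if_neg hy, Finset.mem_filter] at hi
      exact Legs.sees_of_adj hi.2
  have hseg := sum_add_sum_le_of_segments (D := D) hMN (Finset.card_pos.1 (by omega)) hBper
    (fun r s hrs hsr hr hs' hfirst => by
      obtain ⟨h1, h2⟩ := hnx _ hr r s rfl hrs hsr hs' hfirst
      have h3 := hDle (r % N)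
      refine hL.segment_le hf hg hdisj hc2 hBc hBsees (a := U (r % N)) (b := U (nx (r % N)))
        (fun h => hnot _ hr (h ▸ rfl)) hrs h1 (hBM r hr) (h2 ▸ hBM s hs') (by omega) (hDlong _ hr))
  have hsum : ∑ y ∈ Finset.range N, (B y).card =
      ∑ y ∈ Finset.range N \ M, Legs.ends G c ℓ z (g y) + k := by
    rw [← Finset.sum_sdiff hMN, ← hMk, Finset.card_eq_sum_ones M]
    congr 1
    · refine Finset.sum_congr rfl fun y hy => ?_
      rw [Finset.mem_sdiff, Finset.mem_range] at hy
      simp only [hB, Nat.mod_eq_of_lt hy.1, if_neg hy.2]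
      rfl
    · refine Finset.sum_congr rfl fun y hy => ?_
      rw [hBM y (by rwa [Nat.mod_eq_of_lt (Finset.mem_range.1 (hMN hy))]), Finset.card_singleton]
  have hphi := Legs.sum_phi_sub_le (G := G) (g := g) (N := N) (c := c) (ℓ := ℓ) (z := z) hMk
  have hdef := hL.sum_deficit_le hf hs hgA (k := k) hd
    (E := fun v => ∑ y ∈ M with (U y + 1) % c = v, (d - k - D y)) (by
      intro v hv hpos
      obtain ⟨y, hy, hy0⟩ := Finset.exists_ne_zero_of_sum_ne_zero hpos.ne'
      obtain ⟨hyM, rfl⟩ := Finset.mem_filter.1 hy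
      have hsingle : (M.filter fun y' => (U y' + 1) % c = (U y + 1) % c) = {y} := by
        refine Finset.eq_singleton_iff_unique_mem.2 ⟨hy, fun y' hy' => ?_⟩
        rw [Finset.mem_filter] at hy'
        exact hUmod _ hy'.1 _ hyM (Nat.ModEq.add_right_cancel' 1 hy'.2)
      rw [hsingle, Finset.sum_singleton]
      have hmod : (U y + 1) % c ≡ U y + 1 [MOD c] := Nat.mod_modEq _ _
      have htr : ∀ i, Legs.tr G f ℓ z i ((U y + 1) % c) = Legs.tr G f ℓ z i (U y + 1) := by
        intro i
        simp only [Legs.tr, hf.eq_of_modEq hmod]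
      rw [hf.eq_of_modEq hmod, hL.len_eq hmod]
      simp only [htr]
      refine ⟨D y, by omega, fun _ => ?_, fun i hi hi1 h => ?_⟩
      · exact hDmax y (by omega) _ (hL.long_phi hf hc2 (hnot y hyM))
      · refine hDmax y (by omega) _ (hL.long_total_of_modEq hf hi1 (hnot y hyM) ?_)
        exact h.imp_left fun h => hmod.symm.trans (congrArg (· % c) h))
  rw [Finset.sum_fiberwise_of_maps_to (fun y _ => Finset.mem_range.2 (Nat.mod_lt _ hcpos))] at hdef
  have htotal : ∑ y ∈ M, (d - k - D y) + ∑ y ∈ M, (D y + 1) + k = k * (d - k + 2) := by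
    have h : ∑ y ∈ M, (d - k - D y) + ∑ y ∈ M, (D y + 1) = M.card • (d - k + 1) := by
      rw [← Finset.sum_add_distrib, ← Finset.sum_const]
      refine Finset.sum_congr rfl fun y _ => ?_
      have := hDle y
      omega
    rw [h, hMk, smul_eq_mul]
    ring
  have hncard := hL.add_sum_le_ncard
  omega

end CycSeq

theorem CycSeq.ncard_range {G : SimpleGraph V} {A : Set V} {f : ℕ → V} {c : ℕ}
    (hf : CycSeq G A f c) : (Set.range f).ncard = c := by
  have h : Set.range f = f '' (Finset.range c : Set ℕ) := by
    ext x
    rw [hf.mem_range_iff]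
    simp
  have hinj : Set.InjOn f (Finset.range c : Set ℕ) := by
    intro i hi j hj hij
    simp only [Finset.coe_range, Set.mem_Iio] at hi hj
    exact (hf.inj _ _ hij).eq_of_lt_of_lt hi hj
  rw [h, hinj.ncard_image, Set.ncard_coe_finset, Finset.card_range]

namespace IsKConnected

variable [Fintype V] {G : SimpleGraph V}

theorem mono {k l : ℕ} (hG : IsKConnected G l) (hkl : k ≤ l) : IsKConnected G k :=
  ⟨(Nat.succ_le_succ hkl).trans hG.1, fun S hS => hG.2 S (hS.trans_le hkl)⟩

theorem le_minDegree [DecidableRel G.Adj] {l : ℕ} (hG : IsKConnected G l) : l ≤ G.minDegree := by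
  classical
  by_contra! hcon
  have hcard := hG.1
  have : Nonempty V := Fintype.card_pos_iff.1 (by omega)
  obtain ⟨v, hv⟩ := G.exists_minimal_degree_vertex
  have hS : (G.neighborFinset v).card < l := by rw [G.card_neighborFinset_eq_degree]; omega
  have hconn := hG.2 _ hS
  obtain ⟨w, hw⟩ : ∃ w, w ∉ insert v (G.neighborFinset v) := by
    by_contra! h
    have h1 := Finset.card_le_card (fun x _ => h x : Finset.univ ⊆ insert v (G.neighborFinset v))
    have h2 := Finset.card_insert_le v (G.neighborFinset v)
    rw [Finset.card_univ] at h1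
    omega
  rw [Finset.mem_insert, not_or] at hw
  obtain ⟨p⟩ := hconn.preconnected ⟨v, by simp⟩ ⟨w, hw.2⟩
  cases p with
  | nil => exact hw.1 rfl
  | @cons _ x _ h _ => exact x.2 (by simpa using h)

end IsKConnected

theorem CycSeq.length_lt [Fintype V] {G : SimpleGraph V} {A : Set V} {f g : ℕ → V} {c N : ℕ}
    (hf : CycSeq G A f c) (hg : CycSeq G Set.univ g N) (hA : A = (Set.range g)ᶜ) {d k : ℕ}
    (hd : ∀ x, d ≤ (G.neighborSet x).ncard) (hk1 : 1 ≤ k) (hkd : 2 * k ≤ d + 1)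
    (hdN : d + 1 ≤ N) (hG : IsKConnected G k)
    (hcard : Fintype.card V + 2 ≤ (k + 1) * (d - k + 2)) : c < k := by
  by_contra! hkc
  have hn : N + A.ncard = Fintype.card V := by
    rw [← hg.ncard_range, hA, Set.ncard_add_ncard_compl, Nat.card_eq_fintype_card]
  obtain ⟨e, rfl⟩ : ∃ e, d = k + e := ⟨d - k, by omega⟩
  rw [Nat.add_sub_cancel_left] at hcard
  rcases le_or_gt c (e + 1) with hc | hc
  · have h := hf.add_one_mul_degree_le hg hA hd (by omega)
    obtain ⟨a, rfl⟩ := Nat.exists_eq_add_of_le hkc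
    obtain ⟨b, hb⟩ := Nat.exists_eq_add_of_le hc
    obtain rfl : e = k + a + b - 1 := by omega
    obtain ⟨m, rfl⟩ : ∃ m, k = m + 1 := ⟨k - 1, by omega⟩
    rw [show m + 1 + a + b - 1 = m + a + b by omega] at h hcard
    nlinarith [Nat.zero_le (a * b)]
  · have hcA : c ≤ A.ncard := by
      rw [← hf.ncard_range]
      refine Set.ncard_le_ncard ?_
      rintro _ ⟨i, rfl⟩
      exact hf.mem i
    rcases hk1.eq_or_lt with rfl | hk2
    · omega
    · have h := hf.mul_degree_le_of_linked hg hA hd hk2 (by omega) (by omega)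
        fun U hU => hG.le_ncard (by rw [hf.ncard_range]; exact hkc)
          (by rw [hg.ncard_range]; omega) hU
      rw [Nat.add_sub_cancel_left] at h
      nlinarith

end

/-- Theorem 1: if `G` is `l`-connected and `δ ≥ (n+2)/(l+1) + l - 2` then a longest
cycle `C` satisfies `c̄ ≤ min (l-1) (δ-l)`. -/
theorem stmt_0 {V : Type*} [Fintype V] [DecidableEq V] (G : SimpleGraph V)
    [DecidableRel G.Adj] (l : ℕ) (hl : 1 ≤ l) (hconn : IsKConnected G l)
    {v : V} (C : G.Walk v v) (hC : IsLongestCycle G C)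
    (hdeg : (G.minDegree : ℝ) ≥ ((Fintype.card V : ℝ) + 2) / ((l : ℝ) + 1) + (l : ℝ) - 2) :
    (cbar (G.induce {x : V | x ∉ C.support}) : ℤ) ≤
      min ((l : ℤ) - 1) ((G.minDegree : ℤ) - (l : ℤ)) := by
  have hlδ := hconn.le_minDegree
  set d := G.minDegree with hd
  set A := {x : V | x ∉ C.support} with hA
  have hcard : Fintype.card V + 2 ≤ (l + 1) * (d - l + 2) := by
    have h : ((Fintype.card V : ℝ) + 2) / ((l : ℝ) + 1) ≤ (d : ℝ) - l + 2 := by linarith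
    rw [div_le_iff₀ (by positivity), ← Nat.cast_sub hlδ] at h
    rw [mul_comm]
    exact_mod_cast h
  rcases A.eq_empty_or_nonempty with hA0 | hA0
  · have h0 : cbar (G.induce A) = 0 := by
      rw [hA0]
      simp [cbar]
    rw [h0, le_min_iff]
    omega
  obtain ⟨f, hf⟩ := CycSeq.exists_cbar G hA0
  obtain ⟨g, hg, hgr⟩ := CycSeq.exists_of_isCycle hC.1 (fun _ _ => Set.mem_univ _)
    fun y w hw _ => hC.2 y w hw
  have hdV : ∀ x, d ≤ (G.neighborSet x).ncard := by
    intro x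
    rw [Set.ncard_eq_toFinset_card', Set.toFinset_card, G.card_neighborSet_eq_degree]
    exact G.minDegree_le_degree x
  have h3 := hC.1.three_le_length
  have hdN : d + 1 ≤ C.length := by
    have : Nonempty V := ⟨v⟩
    by_cases h2 : 2 ≤ d
    · exact CycSeq.degree_add_one_le hdV h2 hC.2
    · omega
  have hc := hf.length_lt hg (by rw [hgr]; rfl) (k := min l (d + 1 - l)) hdV (by omega) (by omega)
    hdN (hconn.mono (min_le_left _ _)) (by
      obtain ⟨a, ha⟩ : ∃ a, d = l + a := ⟨d - l, by omega⟩
      rw [ha, Nat.add_sub_cancel_left] at hcard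
      rcases le_total l (d + 1 - l) with h | h
      · rw [min_eq_left h, ha, Nat.add_sub_cancel_left]
        exact hcard
      · rw [min_eq_right h, show d + 1 - l = a + 1 by omega, show d - (a + 1) + 2 = l + 1 by omega,
          mul_comm]
        exact hcard)
  rw [le_min_iff]
  omega
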